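/- Let K ⊂ ℝ² be a compact sub-uniformly distributed set with dimH(K) = t ∈ (0,2), and let s satisfy max{t−1, 0} < s ≤ 1. Then for a.e. e ∈ S¹, dimH({z ∈ K : the lower box dimension of K ∩ ℓ_{e,z} is ≥ s}) ≤ max{t−s, 0}. -/

import Mathlib

open MeasureTheory Metric Set
open scoped ENNReal NNReal

noncomputable section

/-- The Euclidean plane ℝ². -/
abbrev Plane := EuclideanSpace ℝ (Fin 2)

/-- The unit circle S¹ ⊆ ℝ². -/
def unitCircle : Set Plane := Metric.sphere (0 : Plane) 1

/-- The line `ℓ_{e,z} = z + span(e)` through `z` in direction `e`. -/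
def lineThrough (e z : Plane) : Set Plane := {w | ∃ r : ℝ, w = z + r • e}


/-- The standard (half-open) dyadic cube of side length `2^{-k}` indexed by `m : Fin d → ℤ`. -/
def dyadicCube (d k : ℕ) (m : Fin d → ℤ) : Set (EuclideanSpace ℝ (Fin d)) :=
  {x | ∀ i, (m i : ℝ) * (2 : ℝ) ^ (-(k : ℤ)) ≤ x i ∧
            x i < ((m i : ℝ) + 1) * (2 : ℝ) ^ (-(k : ℤ))}

/-- The dyadic `2^{-k}`-covering number `|P|_{2^{-k}}`: the number of standard dyadic cubes of
side length `2^{-k}` intersecting `P`. -/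
def covNum (d k : ℕ) (P : Set (EuclideanSpace ℝ (Fin d))) : ℕ :=
  Set.ncard {m : Fin d → ℤ | (dyadicCube d k m ∩ P).Nonempty}

/-- A bounded set `K ⊆ ℝ^d` is sub-uniformly distributed if there is `C > 0` with
`|K|_R · |K ∩ Q|_r ≤ C·|K|_r` for all dyadic scales `r = 2^{-k} ≤ R = 2^{-j}` and every dyadic
`R`-cube `Q` intersecting `K`. -/
def SubUniformlyDistributed {d : ℕ} (K : Set (EuclideanSpace ℝ (Fin d))) : Prop :=
  Bornology.IsBounded K ∧ ∃ C : ℝ, 0 < C ∧ ∀ j k : ℕ, j ≤ k → ∀ m : Fin d → ℤ,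
    (dyadicCube d j m ∩ K).Nonempty →
    (covNum d j K : ℝ) * (covNum d k (K ∩ dyadicCube d j m) : ℝ)
      ≤ C * (covNum d k K : ℝ)


/-- The lower box (Minkowski) dimension, computed along dyadic scales:
`liminf_{k→∞} log |A|_{2^{-k}} / log (2^k)`. -/
def lowerBoxDim {d : ℕ} (A : Set (EuclideanSpace ℝ (Fin d))) : ℝ :=
  Filter.liminf (fun k : ℕ => Real.log (covNum d k A) / ((k : ℝ) * Real.log 2)) Filter.atTop

/-- The upper box (Minkowski) dimension, computed along dyadic scales:
`limsup_{k→∞} log |A|_{2^{-k}} / log (2^k)`. -/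
def upperBoxDim {d : ℕ} (A : Set (EuclideanSpace ℝ (Fin d))) : ℝ :=
  Filter.limsup (fun k : ℕ => Real.log (covNum d k A) / ((k : ℝ) * Real.log 2)) Filter.atTop

/-! ### Part 1: the kernel estimate -/

/-- Autocorrelation of `φ`. -/
def autoCorr (φ : ℝ → ℝ) (u : ℝ) : ℝ := ∫ y, φ y * φ (y + u)

/-- Tent cutoff. -/
def tent (n : ℝ) (a : ℝ) : ℝ := max 0 (min 1 (n + 1 - |a|))

lemma tent_nonneg (n a : ℝ) : 0 ≤ tent n a := le_max_left _ _

lemma tent_le_one (n a : ℝ) : tent n a ≤ 1 := max_le zero_le_one (min_le_left _ _)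

lemma tent_eq_zero {n a : ℝ} (h : n + 1 ≤ |a|) : tent n a = 0 := by
  unfold tent
  apply max_eq_left
  exact (min_le_right _ _).trans (by linarith)

lemma tent_eq_one {n a : ℝ} (h : |a| ≤ n) : tent n a = 1 := by
  unfold tent
  rw [min_eq_left (by linarith)]
  norm_num

lemma tent_lip (n a b : ℝ) : |tent n a - tent n b| ≤ |a - b| := by
  unfold tent
  have h1 := abs_max_sub_max_le_abs (min 1 (n + 1 - |a|)) (min 1 (n + 1 - |b|)) 0
  rw [max_comm 0, max_comm 0]
  refine h1.trans ?_
  have h2 := abs_min_sub_min_le_max 1 (n + 1 - |a|) 1 (n + 1 - |b|)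
  refine h2.trans ?_
  have h3 : |n + 1 - |a| - (n + 1 - |b|)| ≤ |a - b| := by
    have := abs_abs_sub_abs_le b a
    rw [abs_sub_comm a b]
    have e : n + 1 - |a| - (n + 1 - |b|) = |b| - |a| := by ring
    rw [e]
    exact this
  simpa using h3

lemma tent_cont (n : ℝ) : Continuous (tent n) := by
  unfold tent; fun_prop

structure KernelHyp (φ : ℝ → ℝ) (c V : ℝ) : Prop where
  meas : Measurable φ
  c0 : 0 ≤ c
  V0 : 0 ≤ V
  bdd : ∀ x, |φ x| ≤ c
  supp : ∀ x, V < |x| → φ x = 0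
  int0 : ∫ x, φ x = 0

lemma KernelHyp.integrable {φ : ℝ → ℝ} {c V : ℝ} (h : KernelHyp φ c V) : Integrable φ := by
  have : IntegrableOn φ (Icc (-V) V) := by
    apply Measure.integrableOn_of_bounded (M := c)
    · simp
    · exact h.meas.aestronglyMeasurable
    · exact Filter.Eventually.of_forall (fun x => by simpa using h.bdd x)
  apply this.integrable_of_forall_notMem_eq_zero
  intro x hx
  apply h.supp
  by_contra hh
  exact hx (abs_le.mp (not_lt.mp hh))

lemma KernelHyp.integrable_mul {φ : ℝ → ℝ} {c V : ℝ} (h : KernelHyp φ c V) (u : ℝ) :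
    Integrable (fun y => φ y * φ (y + u)) := by
  apply h.integrable.mul_bdd (c := c)
  · exact (h.meas.comp (by fun_prop)).aestronglyMeasurable
  · exact Filter.Eventually.of_forall (fun x => by simpa using h.bdd _)

lemma KernelHyp.corr_meas {φ : ℝ → ℝ} {c V : ℝ} (h : KernelHyp φ c V) :
    Measurable (autoCorr φ) := by
  have : Measurable (fun p : ℝ × ℝ => φ p.2 * φ (p.2 + p.1)) := by
    have := h.meas
    fun_prop
  exact (this.stronglyMeasurable.integral_prod_right (ν := volume)).measurable

lemma KernelHyp.corr_bdd {φ : ℝ → ℝ} {c V : ℝ} (h : KernelHyp φ c V) (u : ℝ) :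
    |autoCorr φ u| ≤ c * c * (2 * V) := by
  unfold autoCorr
  have h1 : ∫ y, φ y * φ (y + u) = ∫ y in Icc (-V) V, φ y * φ (y + u) := by
    symm
    apply setIntegral_eq_integral_of_forall_compl_eq_zero
    intro x hx
    rw [h.supp, zero_mul]
    by_contra hh
    exact hx (abs_le.mp (not_lt.mp hh))
  rw [h1]
  have := norm_setIntegral_le_of_norm_le_const (μ := volume) (s := Icc (-V) V) (C := c * c)
    (f := fun y => φ y * φ (y + u)) (by simp) (fun x _ => by
      rw [norm_mul]
      exact mul_le_mul (h.bdd _) (h.bdd _) (norm_nonneg _) h.c0)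
  rw [Real.norm_eq_abs] at this
  refine this.trans (le_of_eq ?_)
  have hV := h.V0
  simp [Measure.real]
  left
  rw [ENNReal.toReal_ofReal (by linarith)]
  ring

lemma KernelHyp.corr_supp {φ : ℝ → ℝ} {c V : ℝ} (h : KernelHyp φ c V) (u : ℝ)
    (hu : 2 * V < |u|) : autoCorr φ u = 0 := by
  unfold autoCorr
  have : ∀ y, φ y * φ (y + u) = 0 := by
    intro y
    by_cases hy : V < |y|
    · rw [h.supp y hy, zero_mul]
    · rw [h.supp (y + u), mul_zero]
      have : |u| ≤ |y + u| + |y| := by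
        have := abs_sub (y + u) y
        simpa using this
      linarith
  simp [this]

lemma KernelHyp.corr_integrable {φ : ℝ → ℝ} {c V : ℝ} (h : KernelHyp φ c V) :
    Integrable (autoCorr φ) := by
  have : IntegrableOn (autoCorr φ) (Icc (-(2 * V)) (2 * V)) := by
    apply Measure.integrableOn_of_bounded (M := c * c * (2 * V))
    · simp
    · exact h.corr_meas.aestronglyMeasurable
    · exact Filter.Eventually.of_forall (fun x => by simpa using h.corr_bdd x)
  apply this.integrable_of_forall_notMem_eq_zero
  intro x hx
  apply h.corr_supp
  by_contra hh
  exact hx (abs_le.mp (not_lt.mp hh))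

lemma KernelHyp.corr_int {φ : ℝ → ℝ} {c V : ℝ} (h : KernelHyp φ c V) :
    ∫ u, autoCorr φ u = 0 := by
  unfold autoCorr
  rw [integral_integral_swap]
  · have : ∀ y : ℝ, ∫ u, φ y * φ (y + u) = 0 := by
      intro y
      rw [integral_const_mul, integral_add_left_eq_self (fun u => φ u) y, h.int0, mul_zero]
    simp [this]
  · have hm : Measurable (Function.uncurry fun x y : ℝ => φ y * φ (y + x)) := by
      have := h.meas
      unfold Function.uncurry
      fun_prop
    have : IntegrableOn (Function.uncurry fun x y : ℝ => φ y * φ (y + x))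
        (Icc (-(2 * V)) (2 * V) ×ˢ Icc (-V) V) (volume.prod volume) := by
      apply Measure.integrableOn_of_bounded (M := c * c)
      · rw [Measure.prod_prod]
        simp [ENNReal.mul_eq_top]
      · exact hm.aestronglyMeasurable
      · refine Filter.Eventually.of_forall (fun x => ?_)
        simp only [Function.uncurry]
        rw [norm_mul]
        exact mul_le_mul (h.bdd _) (h.bdd _) (norm_nonneg _) h.c0
    apply this.integrable_of_forall_notMem_eq_zero
    rintro ⟨u, y⟩ hx
    simp only [Function.uncurry]
    by_cases hy : V < |y|
    · rw [h.supp y hy, zero_mul]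
    · rw [h.supp (y + u), mul_zero]
      have h3 : |u| ≤ |y + u| + |y| := by
        have := abs_sub (y + u) y
        simpa using this
      by_contra hh
      apply hx
      refine ⟨abs_le.mp ?_, abs_le.mp (not_lt.mp hy)⟩
      simp only
      linarith

/-- Main kernel bound. -/
lemma KernelHyp.main {φ : ℝ → ℝ} {c V : ℝ} (h : KernelHyp φ c V) (n : ℝ) (hn : 0 ≤ n) :
    ∃ C : ℝ, 0 ≤ C ∧ ∀ p q : ℤ, ∫ a, tent n a * autoCorr φ (q - a * p)
      ≤ C / ((1 + |(p : ℝ)|) * (1 + |(q : ℝ)|)) := by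
  have hV := h.V0
  have hc := h.c0
  set M := c * c * (2 * V) with hM
  have hM0 : 0 ≤ M := by positivity
  refine ⟨M * (2 * (n + 1)) * (1 + 2 * V) + M * (2 * V) * (4 * V) * (2 * (n + 2 + 2 * V)),
    by positivity, ?_⟩
  intro p q
  have hden : 0 < (1 + |(p : ℝ)|) * (1 + |(q : ℝ)|) := by positivity
  rw [le_div_iff₀ hden]
  by_cases hp : p = 0
  · subst hp
    simp only [Int.cast_zero, mul_zero, sub_zero, abs_zero, add_zero, one_mul]
    rw [integral_mul_const]
    by_cases hq : 2 * V < |(q : ℝ)|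
    · rw [h.corr_supp _ hq]
      simp
      positivity
    · have h1 : ∫ a, tent n a ≤ 2 * (n + 1) := by
        have : ∫ a, tent n a = ∫ a in Icc (-(n+1)) (n+1), tent n a := by
          symm
          apply setIntegral_eq_integral_of_forall_compl_eq_zero
          intro x hx
          apply tent_eq_zero
          by_contra hh
          exact hx (abs_le.mp (not_le.mp hh).le)
        rw [this]
        have := norm_setIntegral_le_of_norm_le_const (μ := volume) (s := Icc (-(n+1)) (n+1))
          (C := 1) (f := tent n) (by simp) (fun x _ => by
            rw [Real.norm_eq_abs, abs_of_nonneg (tent_nonneg _ _)]; exact tent_le_one _ _)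
        refine (le_abs_self _).trans (this.trans (le_of_eq ?_))
        simp [Measure.real]
        rw [ENNReal.toReal_ofReal (by linarith)]
        ring
      have h0 : 0 ≤ ∫ a, tent n a := integral_nonneg (tent_nonneg n)
      have h2 := h.corr_bdd q
      have h2' := le_abs_self (autoCorr φ q)
      have h3 : (∫ a, tent n a) * autoCorr φ q ≤ 2 * (n + 1) * M := by
        calc _ ≤ (∫ a, tent n a) * M := by gcongr; linarith
          _ ≤ _ := by gcongr
      calc (∫ a, tent n a) * autoCorr φ q * (1 + |(q : ℝ)|)
          ≤ 2 * (n + 1) * M * (1 + |(q : ℝ)|) := by gcongr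
        _ ≤ 2 * (n + 1) * M * (1 + 2 * V) := by gcongr; linarith
        _ ≤ _ := by
          have : 0 ≤ M * (2 * V) * (4 * V) * (2 * (n + 2 + 2 * V)) := by positivity
          linarith
  · have hp1 : (1 : ℝ) ≤ |(p : ℝ)| := by
      have := Int.one_le_abs hp
      exact_mod_cast this
    have hpR : (p : ℝ) ≠ 0 := by exact_mod_cast hp
    -- change of variables
    have hcv : ∫ a, tent n a * autoCorr φ (q - a * p)
        = |(p : ℝ)|⁻¹ * ∫ u, tent n ((q - u) / p) * autoCorr φ u := by
      have e1 := integral_sub_left_eq_self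
        (fun u => tent n ((q - u) / p) * autoCorr φ u) volume (q : ℝ)
      rw [← e1]
      have e2 := Measure.integral_comp_mul_right
        (fun u => tent n ((q - (q - u)) / p) * autoCorr φ (q - u)) (p : ℝ)
      rw [abs_inv, smul_eq_mul] at e2
      rw [← e2]
      congr 1
      ext a
      congr 2
      field_simp
      ring
    have hint : Integrable (fun u => tent n ((q - u) / p) * autoCorr φ u) := by
      apply h.corr_integrable.bdd_mul (c := 1)
      · have := tent_cont n
        exact (this.comp (by fun_prop : Continuous fun u : ℝ => ((q : ℝ) - u) / p)).aestronglyMeasurable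
      · refine Filter.Eventually.of_forall (fun x => ?_)
        rw [Real.norm_eq_abs, abs_of_nonneg (tent_nonneg _ _)]; exact tent_le_one _ _
    have hdiff : ∫ u, tent n ((q - u) / p) * autoCorr φ u
        = ∫ u, (tent n ((q - u) / p) - tent n (q / p)) * autoCorr φ u := by
      simp_rw [sub_mul]
      rw [integral_sub hint (h.corr_integrable.const_mul _), integral_const_mul, h.corr_int]
      simp
    have hset : ∫ u, (tent n ((q - u) / p) - tent n (q / p)) * autoCorr φ u
        = ∫ u in Icc (-(2*V)) (2*V), (tent n ((q - u) / p) - tent n (q / p)) * autoCorr φ u := by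
      symm
      apply setIntegral_eq_integral_of_forall_compl_eq_zero
      intro x hx
      rw [h.corr_supp, mul_zero]
      by_contra hh
      exact hx (abs_le.mp (not_lt.mp hh))
    have hb : |∫ u in Icc (-(2*V)) (2*V), (tent n ((q - u) / p) - tent n (q / p)) * autoCorr φ u|
        ≤ (2 * V) / |(p : ℝ)| * M * (4 * V) := by
      have := norm_setIntegral_le_of_norm_le_const (μ := volume) (s := Icc (-(2*V)) (2*V))
          (C := (2 * V) / |(p : ℝ)| * M)
          (f := fun u => (tent n ((q - u) / p) - tent n (q / p)) * autoCorr φ u)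
          (by simp) (fun x hx => by
            rw [norm_mul]
            refine mul_le_mul ?_ (h.corr_bdd _) (norm_nonneg _) (by positivity)
            refine (tent_lip _ _ _).trans ?_
            have : ((q : ℝ) - x) / p - q / p = - x / p := by ring
            rw [this, abs_div, abs_neg]
            gcongr
            exact abs_le.mpr hx)
      refine this.trans (le_of_eq ?_)
      simp [Measure.real]
      left
      rw [ENNReal.toReal_ofReal (by linarith)]
      ring
    by_cases hq : |(q : ℝ)| ≤ (n + 1 + 2 * V) * |(p : ℝ)|
    · rw [hcv, hdiff, hset]
      have hb' := (le_abs_self _).trans hb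
      calc _ ≤ |(p : ℝ)|⁻¹ * ((2 * V) / |(p : ℝ)| * M * (4 * V)) *
            ((1 + |(p : ℝ)|) * (1 + |(q : ℝ)|)) := by gcongr
        _ ≤ |(p : ℝ)|⁻¹ * ((2 * V) / |(p : ℝ)| * M * (4 * V)) *
            ((|(p : ℝ)| + |(p : ℝ)|) * (|(p : ℝ)| + (n + 1 + 2 * V) * |(p : ℝ)|)) := by gcongr
        _ = M * (2 * V) * (4 * V) * (2 * (n + 2 + 2 * V)) := by
            have : |(p : ℝ)| ≠ 0 := by positivity
            field_simp
            ring
        _ ≤ _ := by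
          have : 0 ≤ M * (2 * (n + 1)) * (1 + 2 * V) := by positivity
          linarith
    · have : ∀ u, tent n ((q - u) / p) * autoCorr φ u = 0 := by
        intro u
        by_cases hu : 2 * V < |u|
        · rw [h.corr_supp _ hu, mul_zero]
        · rw [tent_eq_zero, zero_mul]
          rw [abs_div, le_div_iff₀ (by positivity)]
          have h4 : |(q : ℝ)| ≤ |(q : ℝ) - u| + |u| := by
            have := abs_add_le ((q : ℝ) - u) u
            simpa using this
          push Not at hq hu
          nlinarith
      rw [hcv]
      simp only [this]
      simp
      positivity

/-! ### Part 2: the averaged L² estimate -/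

/-- Normalised intercept of the corner `m` along slope `a`. -/
def lineCoord (a : ℝ) (m : Fin 2 → ℤ) : ℝ := (m 1 : ℝ) - a * (m 0 : ℝ)

/-- The L² energy of the band-limited projection of `S` along slope `a`. -/
def energyG (φ : ℝ → ℝ) (S : Finset (Fin 2 → ℤ)) (a : ℝ) : ℝ :=
  ∑ m ∈ S, ∑ m' ∈ S, autoCorr φ (lineCoord a m' - lineCoord a m)

lemma KernelHyp.prod_eq {φ : ℝ → ℝ} {c V : ℝ} (h : KernelHyp φ c V) (b b' : ℝ) :
    Integrable (fun y => φ (b - y) * φ (b' - y)) ∧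
    ∫ y, φ (b - y) * φ (b' - y) = autoCorr φ (b' - b) := by
  have e : (fun y => φ (b - y) * φ (b' - y)) =
      fun y => (fun x => φ x * φ (x + (b' - b))) (b - y) := by
    ext y
    simp only
    congr 2
    ring
  constructor
  · rw [e]
    exact (h.integrable_mul (b' - b)).comp_sub_left b
  · rw [e, integral_sub_left_eq_self (fun x => φ x * φ (x + (b' - b))) volume b]
    rfl

lemma KernelHyp.energy_eq {φ : ℝ → ℝ} {c V : ℝ} (h : KernelHyp φ c V)
    (S : Finset (Fin 2 → ℤ)) (a : ℝ) :
    Integrable (fun y => (∑ m ∈ S, φ (lineCoord a m - y)) ^ 2) ∧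
    ∫ y, (∑ m ∈ S, φ (lineCoord a m - y)) ^ 2 = energyG φ S a := by
  have e : (fun y => (∑ m ∈ S, φ (lineCoord a m - y)) ^ 2) =
      fun y => ∑ m ∈ S, ∑ m' ∈ S, φ (lineCoord a m - y) * φ (lineCoord a m' - y) := by
    ext y
    rw [sq, Finset.sum_mul_sum]
  rw [e]
  constructor
  · exact integrable_finsetSum _ (fun m _ => integrable_finsetSum _ (fun m' _ =>
      (h.prod_eq _ _).1))
  · rw [integral_finsetSum]
    · unfold energyG
      refine Finset.sum_congr rfl (fun m _ => ?_)
      rw [integral_finsetSum]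
      · exact Finset.sum_congr rfl (fun m' _ => (h.prod_eq _ _).2)
      · exact fun m' _ => (h.prod_eq _ _).1
    · exact fun m _ => integrable_finsetSum _ (fun m' _ => (h.prod_eq _ _).1)

lemma KernelHyp.energy_nonneg {φ : ℝ → ℝ} {c V : ℝ} (h : KernelHyp φ c V)
    (S : Finset (Fin 2 → ℤ)) (a : ℝ) : 0 ≤ energyG φ S a := by
  rw [← (h.energy_eq S a).2]
  exact integral_nonneg (fun y => sq_nonneg _)

lemma KernelHyp.energy_meas {φ : ℝ → ℝ} {c V : ℝ} (h : KernelHyp φ c V)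
    (S : Finset (Fin 2 → ℤ)) : Measurable (energyG φ S) := by
  unfold energyG lineCoord
  refine Finset.measurable_sum _ (fun m _ => Finset.measurable_sum _ (fun m' _ => ?_))
  exact h.corr_meas.comp (by fun_prop)

lemma tent_integrable (n : ℝ) : Integrable (tent n) := by
  have : IntegrableOn (tent n) (Icc (-(n+1)) (n+1)) :=
    (tent_cont n).continuousOn.integrableOn_compact isCompact_Icc
  apply this.integrable_of_forall_notMem_eq_zero
  intro x hx
  apply tent_eq_zero
  by_contra hh
  exact hx (abs_le.mp (not_le.mp hh).le)

lemma KernelHyp.tent_corr_integrable {φ : ℝ → ℝ} {c V : ℝ} (h : KernelHyp φ c V)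
    (n : ℝ) (m m' : Fin 2 → ℤ) :
    Integrable (fun a => tent n a * autoCorr φ (lineCoord a m' - lineCoord a m)) := by
  apply (tent_integrable n).mul_bdd (c := c * c * (2 * V))
  · refine (h.corr_meas.comp ?_).aestronglyMeasurable
    unfold lineCoord
    fun_prop
  · exact Filter.Eventually.of_forall (fun x => by simpa using h.corr_bdd _)

lemma KernelHyp.energy_avg {φ : ℝ → ℝ} {c V : ℝ} (h : KernelHyp φ c V) (n : ℝ) (hn : 0 ≤ n) :
    ∃ C : ℝ, 0 ≤ C ∧ ∀ (S : Finset (Fin 2 → ℤ)) (T : ℤ),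
      (∀ m ∈ S, ∀ m' ∈ S, ∀ i, |m' i - m i| ≤ T) →
      Integrable (fun a => tent n a * energyG φ S a) ∧
      ∫ a, tent n a * energyG φ S a ≤
        C * S.card * (∑ i ∈ Finset.Icc (-T) T, 1 / (1 + |(i : ℝ)|)) ^ 2 := by
  obtain ⟨C, hC, hmain⟩ := h.main n hn
  refine ⟨C, hC, fun S T hT => ?_⟩
  have e : (fun a => tent n a * energyG φ S a) = fun a => ∑ m ∈ S, ∑ m' ∈ S,
      tent n a * autoCorr φ (lineCoord a m' - lineCoord a m) := by
    ext a
    unfold energyG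
    rw [Finset.mul_sum]
    refine Finset.sum_congr rfl (fun m _ => ?_)
    rw [Finset.mul_sum]
  rw [e]
  have hi := fun m m' => h.tent_corr_integrable n m m'
  refine ⟨integrable_finsetSum _ (fun m _ => integrable_finsetSum _ (fun m' _ => hi m m')), ?_⟩
  rw [integral_finsetSum _ (fun m _ => integrable_finsetSum _ (fun m' _ => hi m m'))]
  have key : ∀ m ∈ S, ∫ a, ∑ m' ∈ S, tent n a * autoCorr φ (lineCoord a m' - lineCoord a m)
      ≤ C * (∑ i ∈ Finset.Icc (-T) T, 1 / (1 + |(i : ℝ)|)) ^ 2 := by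
    intro m hm
    rw [integral_finsetSum _ (fun m' _ => hi m m')]
    set F : (Fin 2 → ℤ) → ℝ := fun p => ∏ i, (1 / (1 + |((p i : ℤ) : ℝ)|)) with hF
    have h1 : ∀ m' ∈ S, ∫ a, tent n a * autoCorr φ (lineCoord a m' - lineCoord a m)
        ≤ C * F (m' - m) := by
      intro m' _
      have := hmain (m' 0 - m 0) (m' 1 - m 1)
      rw [hF]
      simp only [Fin.prod_univ_two, Pi.sub_apply]
      convert this using 1
      · congr 1
        ext a
        unfold lineCoord
        push_cast
        ring_nf
      · rw [one_div_mul_one_div, mul_one_div]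
    refine (Finset.sum_le_sum h1).trans ?_
    rw [← Finset.mul_sum]
    gcongr
    have h2 : (∑ i ∈ Finset.Icc (-T) T, 1 / (1 + |(i : ℝ)|)) ^ 2
        = ∑ p ∈ Fintype.piFinset (fun _ : Fin 2 => Finset.Icc (-T) T), F p := by
      have h7 := Finset.prod_univ_sum (fun _ : Fin 2 => Finset.Icc (-T) T)
        (fun _ (j : ℤ) => 1 / (1 + |(j : ℝ)|))
      rw [hF]
      simp only
      rw [← h7]
      simp
    rw [h2]
    have h3 : ∑ m' ∈ S, F (m' - m) = ∑ p ∈ S.image (fun m' => m' - m), F p := by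
      rw [Finset.sum_image]
      intro x _ y _ hxy
      simpa using hxy
    rw [h3]
    apply Finset.sum_le_sum_of_subset_of_nonneg
    · intro p hp
      obtain ⟨m', hm', rfl⟩ := Finset.mem_image.mp hp
      rw [Fintype.mem_piFinset]
      intro i
      rw [Finset.mem_Icc]
      exact abs_le.mp (hT m hm m' hm' i)
    · intro p _ _
      rw [hF]
      positivity
  refine (Finset.sum_le_sum key).trans (le_of_eq ?_)
  simp
  ring

lemma harm_bound (T : ℕ) :
    ∑ i ∈ Finset.Icc (-(T : ℤ)) T, 1 / (1 + |(i : ℝ)|) ≤ 2 * (1 + Real.log (T + 1)) := by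
  have h1 : ∑ i ∈ Finset.Icc (-(T : ℤ)) T, 1 / (1 + |(i : ℝ)|) ≤
      2 * ∑ i ∈ Finset.range (T + 1), 1 / (1 + (i : ℝ)) := by
    have hsub : Finset.Icc (-(T : ℤ)) T ⊆ (Finset.range (T + 1)).image (fun i : ℕ => (i : ℤ)) ∪
        (Finset.range (T + 1)).image (fun i : ℕ => -(i : ℤ)) := by
      intro i hi
      rw [Finset.mem_Icc] at hi
      rw [Finset.mem_union, Finset.mem_image, Finset.mem_image]
      rcases le_total 0 i with h | h
      · left; exact ⟨i.toNat, by rw [Finset.mem_range]; omega, by omega⟩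
      · right; exact ⟨(-i).toNat, by rw [Finset.mem_range]; omega, by omega⟩
    refine (Finset.sum_le_sum_of_subset_of_nonneg hsub (fun _ _ _ => by positivity)).trans ?_
    have hu := Finset.sum_union_inter (s₁ := (Finset.range (T + 1)).image (fun i : ℕ => (i : ℤ)))
      (s₂ := (Finset.range (T + 1)).image (fun i : ℕ => -(i : ℤ)))
      (f := fun i : ℤ => 1 / (1 + |(i : ℝ)|))
    have hn : 0 ≤ ∑ x ∈ (Finset.range (T + 1)).image (fun i : ℕ => (i : ℤ)) ∩
      (Finset.range (T + 1)).image (fun i : ℕ => -(i : ℤ)), 1 / (1 + |(x : ℝ)|) :=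
      Finset.sum_nonneg (fun _ _ => by positivity)
    have ha : ∑ x ∈ (Finset.range (T + 1)).image (fun i : ℕ => (i : ℤ)), 1 / (1 + |(x : ℝ)|)
        = ∑ i ∈ Finset.range (T + 1), 1 / (1 + (i : ℝ)) := by
      rw [Finset.sum_image (fun x _ y _ h => by simpa using h)]
      simp
    have hb : ∑ x ∈ (Finset.range (T + 1)).image (fun i : ℕ => -(i : ℤ)), 1 / (1 + |(x : ℝ)|)
        = ∑ i ∈ Finset.range (T + 1), 1 / (1 + (i : ℝ)) := by
      rw [Finset.sum_image (fun x _ y _ h => by simpa using h)]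
      simp
    rw [ha, hb] at hu
    linarith
  refine h1.trans ?_
  gcongr
  have := harmonic_le_one_add_log (T + 1)
  rw [harmonic] at this
  push_cast at this
  refine le_trans (le_of_eq ?_) this
  refine Finset.sum_congr rfl (fun i _ => ?_)
  rw [one_div, add_comm]

/-- Measure of the set of bad slopes. -/
lemma KernelHyp.bad_measure {φ : ℝ → ℝ} {c V : ℝ} (h : KernelHyp φ c V) (n : ℝ) (hn : 0 ≤ n) :
    ∃ C : ℝ, 0 ≤ C ∧ ∀ (S : Finset (Fin 2 → ℤ)) (T : ℕ),
      (∀ m ∈ S, ∀ m' ∈ S, ∀ i, |m' i - m i| ≤ T) → S.Nonempty → ∀ x : ℝ, 0 < x →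
      volume {a : ℝ | |a| ≤ n ∧ x * S.card ≤ energyG φ S a} ≤
        ENNReal.ofReal (C * (1 + Real.log (T + 1)) ^ 2 / x) := by
  obtain ⟨C, hC, H⟩ := h.energy_avg n hn
  refine ⟨C * 4, by positivity, fun S T hT hS x hx => ?_⟩
  obtain ⟨hint, hle⟩ := H S T hT
  have hcard : (0 : ℝ) < S.card := by exact_mod_cast hS.card_pos
  have hmk := mul_meas_ge_le_integral_of_nonneg (μ := volume)
    (f := fun a => tent n a * energyG φ S a)
    (Filter.Eventually.of_forall (fun a => mul_nonneg (tent_nonneg _ _) (h.energy_nonneg S a)))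
    hint (x * S.card)
  have hsub : {a : ℝ | |a| ≤ n ∧ x * S.card ≤ energyG φ S a} ⊆
      {a | x * S.card ≤ tent n a * energyG φ S a} := by
    rintro a ⟨ha, hb⟩
    change x * S.card ≤ tent n a * energyG φ S a
    rw [tent_eq_one ha, one_mul]
    exact hb
  have hfin : volume {a | x * S.card ≤ tent n a * energyG φ S a} ≠ ⊤ :=
    (hint.measure_ge_lt_top (by positivity)).ne
  refine (measure_mono hsub).trans ?_
  rw [ENNReal.le_ofReal_iff_toReal_le hfin (by positivity), le_div_iff₀ hx]
  have hb := harm_bound T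
  have h0 : 0 ≤ ∑ i ∈ Finset.Icc (-(T : ℤ)) T, 1 / (1 + |(i : ℝ)|) :=
    Finset.sum_nonneg (fun _ _ => by positivity)
  have hsq : (∑ i ∈ Finset.Icc (-(T : ℤ)) T, 1 / (1 + |(i : ℝ)|)) ^ 2
    ≤ (2 * (1 + Real.log (T + 1))) ^ 2 := by gcongr
  have h5 := hmk.trans (hle.trans (mul_le_mul_of_nonneg_left hsq (by positivity)))
  unfold Measure.real at h5
  have h6 : (S.card : ℝ) * (x * (volume {a | x * S.card ≤ tent n a * energyG φ S a}).toReal)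
      ≤ S.card * (C * 4 * (1 + Real.log (T + 1)) ^ 2) := by
    linarith
  have := le_of_mul_le_mul_left h6 hcard
  linarith

/-! ### Part 3: dyadic combinatorics -/

/-- The kernel used: difference of two normalised indicators. -/
def bandKer (α V : ℝ) (x : ℝ) : ℝ :=
  (if |x| ≤ α then 1 / α else 0) - (if |x| ≤ V then 1 / V else 0)

lemma ind_int (V : ℝ) (hV : 0 < V) :
    Integrable (fun x : ℝ => if |x| ≤ V then 1 / V else 0) ∧
    ∫ x : ℝ, (if |x| ≤ V then 1 / V else 0) = 2 := by
  have e : (fun x : ℝ => if |x| ≤ V then 1 / V else 0) =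
      (Icc (-V) V).indicator (fun _ => 1 / V) := by
    ext x
    simp only [indicator, mem_Icc, abs_le]
  rw [e]
  constructor
  · rw [integrable_indicator_iff measurableSet_Icc]
    simp [integrableOn_const_iff]
  · rw [integral_indicator measurableSet_Icc]
    simp [Measure.real]
    rw [ENNReal.toReal_ofReal (by linarith)]
    field_simp
    ring

lemma bandKer_hyp (α V : ℝ) (hα : 0 < α) (hV : α ≤ V) :
    KernelHyp (bandKer α V) (1 / α + 1 / V) V := by
  have hV0 : 0 < V := by linarith
  refine ⟨?_, by positivity, hV0.le, ?_, ?_, ?_⟩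
  · unfold bandKer
    refine Measurable.sub ?_ ?_
    · exact Measurable.ite (measurableSet_le (by fun_prop) (by fun_prop)) (by fun_prop) (by fun_prop)
    · exact Measurable.ite (measurableSet_le (by fun_prop) (by fun_prop)) (by fun_prop) (by fun_prop)
  · intro x
    unfold bandKer
    have h1 : 0 < 1 / α := by positivity
    have h2 : 0 < 1 / V := by positivity
    split_ifs <;> rw [abs_le] <;> constructor <;> linarith
  · intro x hx
    unfold bandKer
    rw [if_neg (by linarith), if_neg (by linarith), sub_zero]
  · unfold bandKer
    rw [integral_sub (ind_int α hα).1 (ind_int V hV0).1, (ind_int α hα).2, (ind_int V hV0).2,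
      sub_self]

/-- Index of the dyadic cube containing `z`. -/
def cell (j : ℕ) (z : Plane) : Fin 2 → ℤ := fun i => ⌊z i * 2 ^ j⌋

lemma mem_cube_iff (j : ℕ) (m : Fin 2 → ℤ) (z : Plane) :
    z ∈ dyadicCube 2 j m ↔ m = cell j z := by
  have h2 : (0 : ℝ) < 2 ^ j := by positivity
  have key : ∀ i, ((m i : ℝ) * (2 : ℝ) ^ (-(j : ℤ)) ≤ z i ∧
            z i < ((m i : ℝ) + 1) * (2 : ℝ) ^ (-(j : ℤ))) ↔ m i = ⌊z i * 2 ^ j⌋ := by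
    intro i
    rw [eq_comm, Int.floor_eq_iff, zpow_neg, zpow_natCast, ← div_eq_mul_inv, ← div_eq_mul_inv,
      div_le_iff₀ h2, lt_div_iff₀ h2]
  constructor
  · intro h
    ext i
    exact (key i).mp (h i)
  · intro h i
    exact (key i).mpr (congrFun h i)

/-- `S j` lists the dyadic cubes of generation `j` meeting `K`. -/
def IsCells (K : Set Plane) (S : ℕ → Finset (Fin 2 → ℤ)) : Prop :=
  ∀ j m, m ∈ S j ↔ (dyadicCube 2 j m ∩ K).Nonempty

lemma isCells_iff {K : Set Plane} {S : ℕ → Finset (Fin 2 → ℤ)} (h : IsCells K S) (j : ℕ)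
    (m : Fin 2 → ℤ) : m ∈ S j ↔ ∃ z ∈ K, m = cell j z := by
  rw [h j m]
  constructor
  · rintro ⟨z, hz, hzK⟩
    exact ⟨z, hzK, (mem_cube_iff _ _ _).mp hz⟩
  · rintro ⟨z, hzK, hz⟩
    exact ⟨z, (mem_cube_iff _ _ _).mpr hz, hzK⟩

lemma exists_cells {K : Set Plane} (hK : Bornology.IsBounded K) :
    ∃ S : ℕ → Finset (Fin 2 → ℤ), IsCells K S ∧ ∃ B : ℕ,
      ∀ j, ∀ m ∈ S j, ∀ m' ∈ S j, ∀ i, |m' i - m i| ≤ ((B * 2 ^ j : ℕ) : ℤ) := by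
  obtain ⟨R, hR⟩ := hK.exists_norm_le
  obtain ⟨B, hB⟩ := exists_nat_ge (R + 1)
  have hcell : ∀ j, ∀ z ∈ K, ∀ i, |cell j z i| ≤ ((B * 2 ^ j : ℕ) : ℤ) := by
    intro j z hz i
    have h1 : |z i| ≤ R := by
      have := PiLp.norm_apply_le z i
      rw [Real.norm_eq_abs] at this
      exact this.trans (hR z hz)
    have h2 : (1 : ℝ) ≤ 2 ^ j := one_le_pow₀ (by norm_num)
    have h3 := Int.floor_le (z i * 2 ^ j)
    have h4 := Int.lt_floor_add_one (z i * 2 ^ j)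
    have h5 := abs_le.mp h1
    have h6 : (|cell j z i| : ℝ) ≤ B * 2 ^ j := by
      unfold cell
      rw [abs_le]
      constructor <;> nlinarith
    have h7 : ((|cell j z i| : ℤ) : ℝ) ≤ (((B * 2 ^ j : ℕ) : ℤ) : ℝ) := by
      push_cast
      exact h6
    exact_mod_cast h7
  have hfin : ∀ j, {m : Fin 2 → ℤ | (dyadicCube 2 j m ∩ K).Nonempty}.Finite := by
    intro j
    apply (Finset.finite_toSet (Fintype.piFinset (fun _ : Fin 2 =>
      Finset.Icc (-((B * 2 ^ j : ℕ) : ℤ)) ((B * 2 ^ j : ℕ) : ℤ)))).subset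
    rintro m ⟨z, hz, hzK⟩
    rw [mem_cube_iff] at hz
    rw [Finset.mem_coe, Fintype.mem_piFinset]
    intro i
    rw [Finset.mem_Icc, hz]
    exact abs_le.mp (hcell j z hzK i)
  have hS : IsCells K (fun j => (hfin j).toFinset) := by
    intro j m
    rw [Set.Finite.mem_toFinset]
    rfl
  refine ⟨_, hS, 2 * B, ?_⟩
  intro j m hm m' hm' i
  obtain ⟨z, hz, rfl⟩ := (isCells_iff hS j m).mp hm
  obtain ⟨z', hz', rfl⟩ := (isCells_iff hS j m').mp hm'
  have h1 := hcell j z hz i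
  have h2 := hcell j z' hz' i
  have h3 := abs_sub (cell j z' i) (cell j z i)
  push_cast at h1 h2 ⊢
  linarith

lemma covNum_eq {K : Set Plane} {S : ℕ → Finset (Fin 2 → ℤ)} (h : IsCells K S) (j : ℕ) :
    covNum 2 j K = (S j).card := by
  unfold covNum
  rw [← Set.ncard_coe_finset]
  congr 1
  ext m
  exact (h j m).symm

/-- Normalised intercept of the line of slope `a` through `z`. -/
def icpt (a : ℝ) (j : ℕ) (z : Plane) : ℝ := (z 1 - a * z 0) * 2 ^ j

/-- Number of cells close to a line. -/
def cnt (S : Finset (Fin 2 → ℤ)) (a y r : ℝ) : ℕ :=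
  (S.filter (fun m => |lineCoord a m - y| ≤ r)).card

lemma cnt_le_card (S : Finset (Fin 2 → ℤ)) (a y r : ℝ) : cnt S a y r ≤ S.card :=
  Finset.card_filter_le _ _

lemma coord_close {a n : ℝ} (ha : |a| ≤ n) (j : ℕ) (z : Plane) :
    |lineCoord a (cell j z) - icpt a j z| ≤ 1 + n := by
  unfold lineCoord icpt cell
  have h3 := Int.floor_le (z 0 * 2 ^ j)
  have h4 := Int.lt_floor_add_one (z 0 * 2 ^ j)
  have h5 := Int.floor_le (z 1 * 2 ^ j)
  have h6 := Int.lt_floor_add_one (z 1 * 2 ^ j)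
  have e : (⌊z 1 * 2 ^ j⌋ : ℝ) - a * ⌊z 0 * 2 ^ j⌋ - (z 1 - a * z 0) * 2 ^ j
      = (⌊z 1 * 2 ^ j⌋ - z 1 * 2 ^ j) + a * (z 0 * 2 ^ j - ⌊z 0 * 2 ^ j⌋) := by ring
  rw [e]
  refine (abs_add_le _ _).trans ?_
  rw [abs_mul]
  have h7 : |(⌊z 1 * 2 ^ j⌋ - z 1 * 2 ^ j : ℝ)| ≤ 1 := by
    rw [abs_le]; constructor <;> linarith
  have h8 : |(z 0 * 2 ^ j - ⌊z 0 * 2 ^ j⌋ : ℝ)| ≤ 1 := by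
    rw [abs_le]; constructor <;> linarith
  have := mul_le_mul ha h8 (abs_nonneg _) ((abs_nonneg a).trans ha)
  linarith

lemma slice_cov {K : Set Plane} {S : ℕ → Finset (Fin 2 → ℤ)} (h : IsCells K S) {a n : ℝ}
    (ha : |a| ≤ n) (e z : Plane) (he : e 1 = a * e 0) (j : ℕ) :
    covNum 2 j (K ∩ lineThrough e z) ≤ cnt (S j) a (icpt a j z) (1 + n) := by
  unfold covNum cnt
  rw [← Set.ncard_coe_finset]
  apply Set.ncard_le_ncard _ (Finset.finite_toSet _)
  rintro m ⟨w, hw, hwK, r, hr⟩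
  rw [mem_cube_iff] at hw
  rw [Finset.mem_coe, Finset.mem_filter, isCells_iff h]
  refine ⟨⟨w, hwK, hw⟩, ?_⟩
  have hi : icpt a j z = icpt a j w := by
    unfold icpt
    rw [hr]
    simp [he]
    ring
  rw [hi, hw]
  exact coord_close ha j w

lemma parent_cnt {K : Set Plane} {S : ℕ → Finset (Fin 2 → ℤ)} (h : IsCells K S) {a n C : ℝ}
    (ha : |a| ≤ n)
    (hC : ∀ j k : ℕ, j ≤ k → ∀ m : Fin 2 → ℤ, (dyadicCube 2 j m ∩ K).Nonempty →
      (covNum 2 j K : ℝ) * (covNum 2 k (K ∩ dyadicCube 2 j m) : ℝ) ≤ C * (covNum 2 k K : ℝ))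
    (i L : ℕ) (z : Plane) :
    ((S i).card : ℝ) * cnt (S (i + L)) a (icpt a (i + L) z) (2 * (1 + n) * 2 ^ L)
      ≤ C * (S (i + L)).card * cnt (S i) a (icpt a i z) (4 * (1 + n)) := by
  classical
  have hn : 0 ≤ n := (abs_nonneg a).trans ha
  set P := (S i).filter (fun m => |lineCoord a m - icpt a i z| ≤ 4 * (1 + n)) with hP
  set Qs := (S (i + L)).filter
    (fun m => |lineCoord a m - icpt a (i + L) z| ≤ 2 * (1 + n) * 2 ^ L) with hQ
  set ch : (Fin 2 → ℤ) → Finset (Fin 2 → ℤ) := fun M => (S (i + L)).filter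
    (fun m => (dyadicCube 2 (i + L) m ∩ (K ∩ dyadicCube 2 i M)).Nonempty) with hch
  have hsub : Qs ⊆ P.biUnion ch := by
    intro m hm
    rw [hQ, Finset.mem_filter] at hm
    obtain ⟨hmS, hmy⟩ := hm
    obtain ⟨x, hxK, rfl⟩ := (isCells_iff h _ _).mp hmS
    rw [Finset.mem_biUnion]
    refine ⟨cell i x, ?_, ?_⟩
    · rw [hP, Finset.mem_filter]
      refine ⟨(isCells_iff h _ _).mpr ⟨x, hxK, rfl⟩, ?_⟩
      have h1 := coord_close ha i x
      have h2 := coord_close ha (i + L) x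
      have h2L : (1 : ℝ) ≤ 2 ^ L := one_le_pow₀ (by norm_num)
      have e1 : ∀ w : Plane, icpt a (i + L) w = icpt a i w * 2 ^ L := by
        intro w; unfold icpt; rw [pow_add]; ring
      have h3 : |icpt a (i + L) x - icpt a (i + L) z| ≤ 3 * (1 + n) * 2 ^ L := by
        have h4 : |icpt a (i + L) x - icpt a (i + L) z| ≤
            |lineCoord a (cell (i + L) x) - icpt a (i + L) x| +
            |lineCoord a (cell (i + L) x) - icpt a (i + L) z| := by
          rw [abs_sub_comm (lineCoord a (cell (i + L) x)) (icpt a (i + L) x)]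
          exact abs_sub_le _ _ _
        nlinarith
      rw [e1, e1, ← sub_mul, abs_mul, abs_of_pos (by positivity : (0 : ℝ) < 2 ^ L)] at h3
      have h5 := le_of_mul_le_mul_right h3 (by positivity)
      have h6 := abs_sub_le (lineCoord a (cell i x)) (icpt a i x) (icpt a i z)
      linarith
    · rw [hch, Finset.mem_filter]
      exact ⟨hmS, x, (mem_cube_iff _ _ _).mpr rfl, hxK, (mem_cube_iff _ _ _).mpr rfl⟩
  have hchild : ∀ M ∈ P, ((S i).card : ℝ) * (ch M).card ≤ C * (S (i + L)).card := by
    intro M hM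
    have hMS : M ∈ S i := Finset.mem_of_mem_filter M hM
    have := hC i (i + L) (Nat.le_add_right _ _) M ((h i M).mp hMS)
    rw [covNum_eq h, covNum_eq h] at this
    refine le_trans (le_of_eq ?_) this
    congr 2
    unfold covNum
    rw [← Set.ncard_coe_finset]
    congr 1
    ext m
    rw [hch, Finset.mem_coe, Finset.mem_filter]
    constructor
    · exact fun hh => hh.2
    · intro hh
      refine ⟨?_, hh⟩
      obtain ⟨x, hx, hxK, _⟩ := hh
      exact (h _ _).mpr ⟨x, hx, hxK⟩
  have h1 : (Qs.card : ℝ) ≤ ∑ M ∈ P, ((ch M).card : ℝ) := by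
    have := (Finset.card_le_card hsub).trans Finset.card_biUnion_le
    exact_mod_cast this
  calc ((S i).card : ℝ) * cnt (S (i + L)) a (icpt a (i + L) z) (2 * (1 + n) * 2 ^ L)
      = (S i).card * Qs.card := rfl
    _ ≤ (S i).card * ∑ M ∈ P, ((ch M).card : ℝ) := by gcongr
    _ = ∑ M ∈ P, ((S i).card : ℝ) * ((ch M).card : ℝ) := Finset.mul_sum _ _ _
    _ ≤ ∑ M ∈ P, C * (S (i + L)).card := Finset.sum_le_sum hchild
    _ = C * (S (i + L)).card * P.card := by simp; ring
    _ = _ := rfl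

/-- The set of points at which scale `j` jumps. -/
def jumpSet (K : Set Plane) (S : ℕ → Finset (Fin 2 → ℤ)) (a n : ℝ) (L j : ℕ) (lam : ℝ) :
    Set Plane :=
  {z | z ∈ K ∧ lam ≤ cnt (S j) a (icpt a j z) (4 * (1 + n)) ∧
    (cnt (S j) a (icpt a j z) (2 * (1 + n) * 2 ^ L) : ℝ) ≤
      2 ^ L / 16 * cnt (S j) a (icpt a j z) (4 * (1 + n))}

lemma sum_bandKer (S : Finset (Fin 2 → ℤ)) (a y α V : ℝ) :
    ∑ m ∈ S, bandKer α V (lineCoord a m - y) = cnt S a y α / α - cnt S a y V / V := by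
  unfold bandKer cnt
  rw [Finset.sum_sub_distrib, ← Finset.sum_filter, ← Finset.sum_filter]
  simp
  ring

lemma hit_count {K : Set Plane} {S : ℕ → Finset (Fin 2 → ℤ)} {a n : ℝ}
    (ha : |a| ≤ n) (L : ℕ) (hL : 3 ≤ L) (j : ℕ) (lam : ℝ) (hlam : 0 < lam)
    (Hit : Finset (Fin 2 → ℤ)) (hHS : Hit ⊆ S j)
    (hH : ∀ m ∈ Hit, ∃ z ∈ jumpSet K S a n L j lam, m = cell j z) :
    (Hit.card : ℝ) * lam ≤ (16 * (1 + n)) ^ 2 *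
      energyG (bandKer (8 * (1 + n)) ((1 + n) * 2 ^ L)) (S j) a := by
  classical
  have hn : 0 ≤ n := (abs_nonneg a).trans ha
  have h2L : (8 : ℝ) ≤ 2 ^ L := by
    calc (8 : ℝ) = 2 ^ 3 := by norm_num
      _ ≤ 2 ^ L := pow_le_pow_right₀ (by norm_num) hL
  set α := 8 * (1 + n) with hα
  set V := (1 + n) * 2 ^ L with hV
  have hα0 : 0 < α := by positivity
  have hV0 : 0 < V := by positivity
  have hαV : α ≤ V := by rw [hα, hV]; nlinarith
  have hK := bandKer_hyp α V hα0 hαV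
  obtain ⟨hint, heq⟩ := hK.energy_eq (S j) a
  -- pointwise inequality
  have hpt : ∀ y : ℝ, (∑ m ∈ Hit, if |y - lineCoord a m| ≤ 1 then (1 / 1 : ℝ) else 0) * lam ≤
      (16 * (1 + n)) ^ 2 * (∑ m ∈ S j, bandKer α V (lineCoord a m - y)) ^ 2 := by
    intro y
    set f := Hit.filter (fun m => |y - lineCoord a m| ≤ 1) with hf
    have e1 : (∑ m ∈ Hit, if |y - lineCoord a m| ≤ 1 then (1 / 1 : ℝ) else 0) = f.card := by
      rw [← Finset.sum_filter]
      simp [hf]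
    rw [e1]
    rcases f.eq_empty_or_nonempty with h0 | ⟨m, hm⟩
    · rw [h0]
      simp
      positivity
    rw [hf, Finset.mem_filter] at hm
    obtain ⟨hmH, hmy⟩ := hm
    obtain ⟨z, ⟨hzK, hz1, hz2⟩, rfl⟩ := hH m hmH
    have hc := coord_close ha j z
    have hyz : |y - icpt a j z| ≤ 2 + n := by
      have := abs_sub_le y (lineCoord a (cell j z)) (icpt a j z)
      linarith
    have hA : (cnt (S j) a (icpt a j z) (4 * (1 + n)) : ℝ) ≤ cnt (S j) a y α := by
      unfold cnt
      refine Nat.cast_le.mpr (Finset.card_le_card ?_)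
      intro m hm
      rw [Finset.mem_filter] at hm ⊢
      refine ⟨hm.1, ?_⟩
      have := abs_sub_le (lineCoord a m) (icpt a j z) y
      rw [abs_sub_comm (icpt a j z) y] at this
      linarith [hm.2]
    have hB : (cnt (S j) a y V : ℝ) ≤ cnt (S j) a (icpt a j z) (2 * (1 + n) * 2 ^ L) := by
      unfold cnt
      refine Nat.cast_le.mpr (Finset.card_le_card ?_)
      intro m hm
      rw [Finset.mem_filter] at hm ⊢
      refine ⟨hm.1, ?_⟩
      have := abs_sub_le (lineCoord a m) y (icpt a j z)
      have h9 := hm.2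
      rw [hV] at h9
      nlinarith
    have hf' : (f.card : ℝ) ≤ cnt (S j) a y α := by
      unfold cnt
      refine Nat.cast_le.mpr (Finset.card_le_card ?_)
      intro m hm
      rw [hf, Finset.mem_filter] at hm
      rw [Finset.mem_filter]
      refine ⟨hHS hm.1, ?_⟩
      rw [abs_sub_comm]
      linarith [hm.2]
    rw [sum_bandKer]
    set A := (cnt (S j) a y α : ℝ) with hAdef
    have hA0 : 0 ≤ A := by positivity
    have hAl : lam ≤ A := hz1.trans hA
    have hBA : (cnt (S j) a y V : ℝ) ≤ 2 ^ L / 16 * A :=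
      hB.trans (hz2.trans (by gcongr))
    have hD : A / (16 * (1 + n)) ≤ A / α - cnt (S j) a y V / V := by
      have h1 : (cnt (S j) a y V : ℝ) / V ≤ A / (16 * (1 + n)) := by
        rw [div_le_div_iff₀ hV0 (by positivity), hV]
        nlinarith
      have h2 : A / α = A / (16 * (1 + n)) + A / (16 * (1 + n)) := by
        rw [hα]; field_simp; ring
      linarith
    have hD2 : (A / (16 * (1 + n))) ^ 2 ≤ (A / α - cnt (S j) a y V / V) ^ 2 := by
      gcongr
    calc (f.card : ℝ) * lam ≤ A * A := by gcongr
      _ = (16 * (1 + n)) ^ 2 * (A / (16 * (1 + n))) ^ 2 := by field_simp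
      _ ≤ _ := by gcongr
  have hI : ∀ m : Fin 2 → ℤ,
      Integrable (fun y : ℝ => if |y - lineCoord a m| ≤ 1 then (1 / 1 : ℝ) else 0) ∧
      ∫ y : ℝ, (if |y - lineCoord a m| ≤ 1 then (1 / 1 : ℝ) else 0) = 2 := by
    intro m
    have := ind_int 1 one_pos
    refine ⟨this.1.comp_sub_right (lineCoord a m), ?_⟩
    rw [integral_sub_right_eq_self (fun y : ℝ => if |y| ≤ 1 then (1 / 1 : ℝ) else 0)
      (lineCoord a m)]
    exact this.2
  have hle := integral_mono
    ((integrable_finsetSum Hit (fun m _ => (hI m).1)).mul_const lam)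
    (hint.const_mul ((16 * (1 + n)) ^ 2)) hpt
  rw [integral_mul_const, integral_finsetSum _ (fun m _ => (hI m).1), integral_const_mul, heq]
    at hle
  simp only [(hI _).2] at hle
  rw [Finset.sum_const, nsmul_eq_mul] at hle
  have : 0 ≤ (Hit.card : ℝ) * lam := by positivity
  linarith

lemma step_down (q : ℕ → ℝ) (L J0 : ℕ) (hL : 0 < L) (hJ : L ≤ J0) (Y a' : ℝ) (hY : 1 ≤ Y)
    (hq : ∀ j : ℕ, j < J0 → q j < Y * (2 : ℝ) ^ ((j : ℝ) * a')) :
    ∀ j : ℕ, Y * (2 : ℝ) ^ ((j : ℝ) * a') ≤ q j →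
      ∃ i, J0 ≤ i + L ∧ (2 : ℝ) ^ (((i + L : ℕ) : ℝ) * a') ≤ q (i + L) ∧
        (2 : ℝ) ^ ((L : ℝ) * a') * q i ≤ q (i + L) := by
  intro j
  induction j using Nat.strong_induction_on with
  | _ j ih =>
    intro hj
    by_cases hlt : j < J0
    · exact absurd hj (not_le.mpr (hq j hlt))
    · push Not at hlt
      obtain ⟨i, rfl⟩ : ∃ i, j = i + L := ⟨j - L, by omega⟩
      by_cases hs : (2 : ℝ) ^ ((L : ℝ) * a') * q i ≤ q (i + L)
      · refine ⟨i, hlt, ?_, hs⟩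
        refine le_trans ?_ hj
        have : (0 : ℝ) < (2 : ℝ) ^ (((i + L : ℕ) : ℝ) * a') := by positivity
        nlinarith
      · push Not at hs
        apply ih i (by omega)
        have h1 := hj.trans hs.le
        have e : (2 : ℝ) ^ (((i + L : ℕ) : ℝ) * a') =
            (2 : ℝ) ^ ((L : ℝ) * a') * (2 : ℝ) ^ ((i : ℝ) * a') := by
          rw [← Real.rpow_add (by norm_num)]
          congr 1
          push_cast
          ring
        rw [e] at h1
        have hp : (0 : ℝ) < (2 : ℝ) ^ ((L : ℝ) * a') := by positivity
        apply le_of_mul_le_mul_left _ hp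
        linarith

/-! ### Part 4: Hausdorff dimension lemmas -/

lemma plane_dist_le (x y : Plane) : dist x y ≤ |x 0 - y 0| + |x 1 - y 1| := by
  rw [EuclideanSpace.dist_eq, Fin.sum_univ_two, Real.dist_eq, Real.dist_eq]
  apply Real.sqrt_le_iff.mpr
  refine ⟨by positivity, ?_⟩
  nlinarith [abs_nonneg (x 0 - y 0), abs_nonneg (x 1 - y 1)]

lemma abs_coord_le (x y : Plane) (i : Fin 2) : |x i - y i| ≤ dist x y := by
  have := PiLp.norm_apply_le (x - y) i
  rw [dist_eq_norm]
  simpa using this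

lemma cube_diam (j : ℕ) (m : Fin 2 → ℤ) :
    ediam (dyadicCube 2 j m) ≤ ENNReal.ofReal (2 * (2 : ℝ) ^ (-(j : ℝ))) := by
  apply ediam_le
  intro x hx y hy
  rw [edist_dist]
  apply ENNReal.ofReal_le_ofReal
  refine (plane_dist_le x y).trans ?_
  have e : (2 : ℝ) ^ (-(j : ℝ)) = (2 : ℝ) ^ (-(j : ℤ)) := by
    rw [← Real.rpow_intCast]
    push_cast
    rfl
  rw [e]
  have key : ∀ i, |x i - y i| ≤ (2 : ℝ) ^ (-(j : ℤ)) := by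
    intro i
    have h1 := hx i
    have h2 := hy i
    rw [abs_le]
    constructor <;> nlinarith
  linarith [key 0, key 1]

lemma limsup_dim (Z : Set Plane) (Hit : ℕ → Finset (Fin 2 → ℤ)) (C ρ d : ℝ) (hC : 0 ≤ C)
    (hd : 0 < d) (hρ : ρ < d) (J1 : ℕ)
    (hcard : ∀ j, J1 ≤ j → ((Hit j).card : ℝ) ≤ C * (2 : ℝ) ^ ((j : ℝ) * ρ))
    (hZ : ∀ z ∈ Z, ∀ J, ∃ j, J ≤ j ∧ ∃ m ∈ Hit j, z ∈ dyadicCube 2 j m) :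
    dimH Z ≤ ENNReal.ofReal d := by
  classical
  set f : ℕ → ℝ := fun j => C * (2 : ℝ) ^ d * ((2 : ℝ) ^ (ρ - d)) ^ j with hf
  have hfs : Summable f := by
    apply Summable.mul_left
    apply summable_geometric_of_lt_one (by positivity)
    apply Real.rpow_lt_one_of_one_lt_of_neg (by norm_num)
    linarith
  have hf0 : ∀ j, 0 ≤ f j := fun j => by rw [hf]; positivity
  have hsum : ∑' j, ENNReal.ofReal (f j) ≠ ⊤ := by
    rw [← ENNReal.ofReal_tsum_of_nonneg hf0 hfs]
    exact ENNReal.ofReal_ne_top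
  set t : (J : ℕ) → (ℕ × (Fin 2 → ℤ)) → Set Plane := fun J p =>
    if p.2 ∈ Hit (p.1 + (J + J1)) then dyadicCube 2 (p.1 + (J + J1)) p.2 else ∅ with ht
  set r : ℕ → ℝ≥0∞ := fun J => ENNReal.ofReal (2 * (2 : ℝ) ^ (-(J : ℝ))) with hr
  have hr0 : Filter.Tendsto r Filter.atTop (nhds 0) := by
    rw [hr, ← ENNReal.ofReal_zero]
    apply ENNReal.tendsto_ofReal
    have h1 : Filter.Tendsto (fun J : ℕ => 2 * ((1 / 2 : ℝ) ^ J)) Filter.atTop (nhds (2 * 0)) :=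
      (tendsto_pow_atTop_nhds_zero_of_lt_one (by norm_num) (by norm_num)).const_mul 2
    rw [mul_zero] at h1
    refine h1.congr (fun J => ?_)
    rw [Real.rpow_neg (by norm_num), Real.rpow_natCast]
    simp
  have hdiam : ∀ J p, ediam (t J p) ≤ r J := by
    intro J p
    rw [ht]
    simp only
    split_ifs
    · refine (cube_diam _ _).trans ?_
      apply ENNReal.ofReal_le_ofReal
      gcongr
      · norm_num
      · omega
    · simp
  have hcov : ∀ J, Z ⊆ ⋃ p, t J p := by
    intro J z hz
    obtain ⟨j, hj, m, hm, hzm⟩ := hZ z hz (J + J1)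
    rw [mem_iUnion]
    refine ⟨(j - (J + J1), m), ?_⟩
    rw [ht]
    simp only
    have : j - (J + J1) + (J + J1) = j := by omega
    rw [this, if_pos hm]
    exact hzm
  have hsumJ : ∀ J, ∑' p, ediam (t J p) ^ d ≤ ∑' i, ENNReal.ofReal (f (i + (J + J1))) := by
    intro J
    rw [ENNReal.tsum_prod (f := fun i m => ediam (t J (i, m)) ^ d)]
    apply ENNReal.tsum_le_tsum
    intro i
    set j := i + (J + J1) with hj
    have h1 : ∑' m, ediam (t J (i, m)) ^ d = ∑ m ∈ Hit j, ediam (t J (i, m)) ^ d := by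
      apply tsum_eq_sum
      intro m hm
      rw [ht]
      simp only
      rw [if_neg hm]
      simp [hd]
    rw [h1]
    have h2 : ∀ m ∈ Hit j, ediam (t J (i, m)) ^ d ≤
        ENNReal.ofReal ((2 * (2 : ℝ) ^ (-(j : ℝ))) ^ d) := by
      intro m hm
      rw [← ENNReal.ofReal_rpow_of_nonneg (by positivity) hd.le]
      apply ENNReal.rpow_le_rpow _ hd.le
      rw [ht]
      simp only
      rw [if_pos hm]
      exact cube_diam _ _
    refine (Finset.sum_le_sum h2).trans ?_
    rw [Finset.sum_const, nsmul_eq_mul, ← ENNReal.ofReal_natCast, ← ENNReal.ofReal_mul (by positivity)]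
    apply ENNReal.ofReal_le_ofReal
    have h3 := hcard j (by omega)
    calc ((Hit j).card : ℝ) * (2 * (2 : ℝ) ^ (-(j : ℝ))) ^ d
        ≤ C * (2 : ℝ) ^ ((j : ℝ) * ρ) * (2 * (2 : ℝ) ^ (-(j : ℝ))) ^ d := by gcongr
      _ = f j := by
        rw [hf]
        simp only
        rw [Real.mul_rpow (by norm_num) (by positivity), ← Real.rpow_mul (by norm_num),
          ← Real.rpow_mul_natCast (by norm_num)]
        have : (2 : ℝ) ^ ((ρ - d) * j) = (2 : ℝ) ^ ((j : ℝ) * ρ) * (2 : ℝ) ^ (-(j : ℝ) * d) := by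
          rw [← Real.rpow_add (by norm_num)]
          congr 1
          ring
        rw [this]
        ring
  have hmeas : μH[d] Z = 0 := by
    have h1 := Measure.hausdorffMeasure_le_liminf_tsum d Z r hr0 t
      (Filter.Eventually.of_forall hdiam) (Filter.Eventually.of_forall hcov)
    have h2 : Filter.Tendsto (fun J => ∑' p, ediam (t J p) ^ d) Filter.atTop (nhds 0) := by
      have h3 := ENNReal.tendsto_sum_nat_add (fun j => ENNReal.ofReal (f j)) hsum
      have h4 := h3.comp (Filter.tendsto_add_atTop_nat J1)
      exact tendsto_of_tendsto_of_tendsto_of_le_of_le tendsto_const_nhds h4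
        (fun _ => zero_le) hsumJ
    rw [h2.liminf_eq] at h1
    exact le_antisymm h1 zero_le
  have := dimH_le_of_hausdorffMeasure_ne_top (s := Z) (d := d.toNNReal)
    (by rw [Real.coe_toNNReal _ hd.le, hmeas]; simp)
  exact this

lemma small_scale (δ η T : ℝ) (k0 : ℕ) (hδ : 0 ≤ δ) (hδ2 : δ ≤ (1 / 2 : ℝ) ^ k0) (hη : 0 < η)
    (hT : 0 < T) :
    ∃ j, k0 ≤ j ∧ δ ≤ (1 / 2 : ℝ) ^ j ∧
      ((1 / 2 : ℝ) ^ j) ^ T ≤ (2 : ℝ) ^ T * δ ^ T + η := by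
  rcases hδ.eq_or_lt with h0 | h0
  · subst h0
    have h1 : Filter.Tendsto (fun j : ℕ => ((1 / 2 : ℝ) ^ T) ^ j) Filter.atTop (nhds 0) :=
      tendsto_pow_atTop_nhds_zero_of_lt_one (by positivity)
        (Real.rpow_lt_one (by norm_num) (by norm_num) hT)
    obtain ⟨j, hj, hj2⟩ := ((h1.eventually_lt_const hη).and (Filter.eventually_ge_atTop k0)).exists
    refine ⟨j, hj2, by positivity, ?_⟩
    rw [Real.zero_rpow hT.ne', mul_zero, zero_add, ← Real.rpow_natCast_mul (by norm_num), mul_comm,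
      Real.rpow_mul_natCast (by norm_num)]
    exact hj.le
  · obtain ⟨j, hj1, hj2⟩ := exists_nat_pow_near_of_lt_one h0
      (hδ2.trans (pow_le_one₀ (by norm_num) (by norm_num))) (by norm_num : (0 : ℝ) < 1 / 2)
      (by norm_num)
    refine ⟨j, ?_, hj2, ?_⟩
    · by_contra hlt
      push Not at hlt
      have : (1 / 2 : ℝ) ^ k0 ≤ (1 / 2 : ℝ) ^ (j + 1) :=
        pow_le_pow_of_le_one (by norm_num) (by norm_num) hlt
      linarith
    · rw [← Real.mul_rpow (by norm_num) hδ]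
      have h3 : (1 / 2 : ℝ) ^ j ≤ 2 * δ := by
        rw [pow_succ] at hj1
        linarith
      have := Real.rpow_le_rpow (by positivity) h3 hT.le
      linarith

lemma good_scales {K : Set Plane} {S : ℕ → Finset (Fin 2 → ℤ)} (h : IsCells K S)
    (hK : IsCompact K) (hne : K.Nonempty) {C : ℝ} (hC0 : 0 < C)
    (hC : ∀ j k : ℕ, j ≤ k → ∀ m : Fin 2 → ℤ, (dyadicCube 2 j m ∩ K).Nonempty →
      (covNum 2 j K : ℝ) * (covNum 2 k (K ∩ dyadicCube 2 j m) : ℝ) ≤ C * (covNum 2 k K : ℝ))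
    (T : ℝ) (hT : 0 < T) (hdim : dimH K < ENNReal.ofReal T) (k0 : ℕ) :
    ∃ k, k0 ≤ k ∧ ((S k).card : ℝ) ≤ (2 : ℝ) ^ ((k : ℝ) * T) := by
  classical
  by_contra hcon
  push Not at hcon
  have hm : μH[T] K = 0 := by
    have := hausdorffMeasure_of_dimH_lt (s := K) (d := T.toNNReal) hdim
    rwa [Real.coe_toNNReal _ hT.le] at this
  -- small cover
  set ε : ℝ := 1 / (200 * C * (2 : ℝ) ^ T) with hε
  have hε0 : 0 < ε := by positivity
  set η : ℝ := 1 / (200 * C) with hη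
  have hη0 : 0 < η := by positivity
  rw [Measure.hausdorffMeasure_apply] at hm
  have hm2 : (⨅ (t : ℕ → Set Plane) (_ : K ⊆ ⋃ n, t n)
      (_ : ∀ n, ediam (t n) ≤ ENNReal.ofReal ((1 / 2 : ℝ) ^ k0)),
          ∑' n, ⨆ _ : (t n).Nonempty, ediam (t n) ^ T) < ENNReal.ofReal ε := by
    have h1 : (⨅ (t : ℕ → Set Plane) (_ : K ⊆ ⋃ n, t n)
      (_ : ∀ n, ediam (t n) ≤ ENNReal.ofReal ((1 / 2 : ℝ) ^ k0)),
          ∑' n, ⨆ _ : (t n).Nonempty, ediam (t n) ^ T) ≤ 0 := by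
      rw [← hm]
      exact le_iSup₂ (f := fun (r : ℝ≥0∞) (_ : 0 < r) => ⨅ (t : ℕ → Set Plane)
        (_ : K ⊆ ⋃ n, t n) (_ : ∀ n, ediam (t n) ≤ r),
          ∑' n, ⨆ _ : (t n).Nonempty, ediam (t n) ^ T) (ENNReal.ofReal ((1 / 2 : ℝ) ^ k0))
          (by rw [ENNReal.ofReal_pos]; positivity)
    exact lt_of_le_of_lt h1 (by rw [ENNReal.ofReal_pos]; exact hε0)
  simp only [iInf_lt_iff] at hm2
  obtain ⟨t, htK, htd, hts⟩ := hm2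
  set τ : ℕ → ℝ≥0∞ := fun n => ⨆ _ : (t n).Nonempty, ediam (t n) ^ T with hτ
  -- choose balls
  have hball : ∀ n, ∃ (x : Plane) (j : ℕ), k0 ≤ j ∧ t n ⊆ ball x (2 * (1 / 2 : ℝ) ^ j) ∧
      ENNReal.ofReal (((1 / 2 : ℝ) ^ j) ^ T) ≤
        ENNReal.ofReal ((2 : ℝ) ^ T) * τ n + ENNReal.ofReal (η / 2 * (1 / 2) ^ n) := by
    intro n
    have hηn : 0 < η / 2 * (1 / 2 : ℝ) ^ n := by positivity
    have hfin : ediam (t n) ≠ ⊤ := ne_top_of_le_ne_top ENNReal.ofReal_ne_top (htd n)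
    have hδ2 : (ediam (t n)).toReal ≤ (1 / 2 : ℝ) ^ k0 :=
      ENNReal.toReal_le_of_le_ofReal (by positivity) (htd n)
    obtain ⟨j, hj0, hj1, hj2⟩ := small_scale (ediam (t n)).toReal (η / 2 * (1 / 2 : ℝ) ^ n) T k0
      ENNReal.toReal_nonneg hδ2 hηn hT
    have hle := ENNReal.ofReal_le_ofReal hj2
    rw [ENNReal.ofReal_add (by positivity) hηn.le, ENNReal.ofReal_mul (by positivity),
      ← ENNReal.ofReal_rpow_of_nonneg ENNReal.toReal_nonneg hT.le, ENNReal.ofReal_toReal hfin]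
      at hle
    rcases (t n).eq_empty_or_nonempty with hemp | ⟨x, hx⟩
    · refine ⟨0, j, hj0, by simp [hemp], hle.trans ?_⟩
      rw [hemp]
      simp [hT]
    · refine ⟨x, j, hj0, ?_, hle.trans ?_⟩
      · intro y hy
        rw [mem_ball]
        have h1 : edist y x ≤ ediam (t n) := edist_le_ediam_of_mem hy hx
        have h2 : dist y x ≤ (ediam (t n)).toReal := by
          rw [dist_edist]
          exact ENNReal.toReal_mono hfin h1
        have h3 : (0 : ℝ) < (1 / 2 : ℝ) ^ j := by positivity
        linarith
      · gcongr
        rw [hτ]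
        simp only
        rw [ciSup_pos ⟨x, hx⟩]
  choose x j hj0 hjb hjs using hball
  obtain ⟨F, hF⟩ := hK.elim_finite_subcover (fun n => ball (x n) (2 * (1 / 2 : ℝ) ^ j n))
    (fun n => isOpen_ball) (htK.trans (iUnion_mono hjb))
  set k := F.sup j with hk
  have hkj : ∀ n ∈ F, j n ≤ k := fun n hn => Finset.le_sup hn
  -- cubes near x n
  set P : ℕ → Finset (Fin 2 → ℤ) := fun n => (Fintype.piFinset (fun i : Fin 2 =>
    Finset.Icc (cell (j n) (x n) i - 3) (cell (j n) (x n) i + 3))).filter (· ∈ S (j n)) with hP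
  have hPc : ∀ n, ((P n).card : ℝ) ≤ 49 := by
    intro n
    have h1 : (P n).card ≤ 49 := by
      refine (Finset.card_filter_le _ _).trans ?_
      rw [Fintype.card_piFinset]
      have e7 : ∀ c : ℤ, (c + 3 + 1 - (c - 3)).toNat = 7 := by intro c; omega
      simp only [Int.card_Icc, e7, Finset.prod_const, Finset.card_univ, Fintype.card_fin]
      norm_num
    exact_mod_cast h1
  set ch : ℕ → (Fin 2 → ℤ) → Finset (Fin 2 → ℤ) := fun i M => (S k).filter
    (fun m => (dyadicCube 2 k m ∩ (K ∩ dyadicCube 2 i M)).Nonempty) with hch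
  have hsub : S k ⊆ F.biUnion (fun n => (P n).biUnion (ch (j n))) := by
    intro m hmS
    obtain ⟨z, hzK, rfl⟩ := (isCells_iff h _ _).mp hmS
    have hzF := hF hzK
    simp only [mem_iUnion] at hzF
    obtain ⟨n, hn, hz⟩ := hzF
    rw [Finset.mem_biUnion]
    refine ⟨n, hn, ?_⟩
    rw [Finset.mem_biUnion]
    refine ⟨cell (j n) z, ?_, ?_⟩
    · rw [hP, Finset.mem_filter, Fintype.mem_piFinset]
      refine ⟨fun i => ?_, (isCells_iff h _ _).mpr ⟨z, hzK, rfl⟩⟩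
      rw [mem_ball] at hz
      have h1 := (abs_coord_le z (x n) i).trans hz.le
      have h2 : |z i * 2 ^ j n - x n i * 2 ^ j n| ≤ 2 := by
        rw [← sub_mul, abs_mul, abs_of_pos (by positivity : (0 : ℝ) < 2 ^ j n)]
        calc |z i - x n i| * 2 ^ j n ≤ 2 * (1 / 2 : ℝ) ^ j n * 2 ^ j n := by gcongr
          _ = 2 := by
            rw [mul_assoc, ← mul_pow]
            norm_num
      rw [abs_le] at h2
      unfold cell
      have h3 := Int.floor_le (z i * 2 ^ j n)
      have h4 := Int.lt_floor_add_one (z i * 2 ^ j n)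
      have h5 := Int.floor_le (x n i * 2 ^ j n)
      have h6 := Int.lt_floor_add_one (x n i * 2 ^ j n)
      rw [Finset.mem_Icc]
      constructor
      · have : ((⌊x n i * 2 ^ j n⌋ - 3 : ℤ) : ℝ) ≤ (⌊z i * 2 ^ j n⌋ : ℤ) := by
          push_cast; linarith
        exact Int.cast_le.mp this
      · have : ((⌊z i * 2 ^ j n⌋ : ℤ) : ℝ) ≤ ((⌊x n i * 2 ^ j n⌋ + 3 : ℤ) : ℝ) := by
          push_cast; linarith
        exact Int.cast_le.mp this
    · rw [hch, Finset.mem_filter]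
      exact ⟨hmS, z, (mem_cube_iff _ _ _).mpr rfl, hzK, (mem_cube_iff _ _ _).mpr rfl⟩
  have hSpos : ∀ i, (0 : ℝ) < (S i).card := by
    intro i
    obtain ⟨z, hz⟩ := hne
    have : 0 < (S i).card := Finset.card_pos.mpr ⟨cell i z, (isCells_iff h _ _).mpr ⟨z, hz, rfl⟩⟩
    exact_mod_cast this
  have hchild : ∀ n ∈ F, ∀ M ∈ P n, ((ch (j n) M).card : ℝ) ≤
      C * (S k).card * ((1 / 2 : ℝ) ^ j n) ^ T := by
    intro n hn M hM
    have hMS : M ∈ S (j n) := by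
      rw [hP, Finset.mem_filter] at hM
      exact hM.2
    have h1 := hC (j n) k (hkj n hn) M ((h _ M).mp hMS)
    rw [covNum_eq h, covNum_eq h] at h1
    have e : covNum 2 k (K ∩ dyadicCube 2 (j n) M) = (ch (j n) M).card := by
      unfold covNum
      rw [← Set.ncard_coe_finset]
      congr 1
      ext m
      rw [hch, Finset.mem_coe, Finset.mem_filter]
      constructor
      · intro hh
        refine ⟨?_, hh⟩
        obtain ⟨x, hx, hxK, _⟩ := hh
        exact (h _ _).mpr ⟨x, hx, hxK⟩
      · exact fun hh => hh.2
    rw [e] at h1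
    have h2 := (hcon (j n) (hj0 n)).le
    have h3 : (2 : ℝ) ^ ((j n : ℝ) * T) * ((1 / 2 : ℝ) ^ j n) ^ T = 1 := by
      rw [Real.rpow_mul (by norm_num), Real.rpow_natCast, ← Real.mul_rpow (by positivity)
        (by positivity), ← mul_pow]
      norm_num
    have h4 : (2 : ℝ) ^ ((j n : ℝ) * T) * (ch (j n) M).card ≤ C * (S k).card :=
      le_trans (by gcongr) h1
    have h5 : (0 : ℝ) < ((1 / 2 : ℝ) ^ j n) ^ T := by positivity
    calc ((ch (j n) M).card : ℝ)
        = ((2 : ℝ) ^ ((j n : ℝ) * T) * (ch (j n) M).card) * ((1 / 2 : ℝ) ^ j n) ^ T := by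
          rw [mul_right_comm, h3, one_mul]
      _ ≤ _ := by gcongr
  have hbig : ((S k).card : ℝ) ≤ 49 * C * (S k).card * ∑ n ∈ F, ((1 / 2 : ℝ) ^ j n) ^ T := by
    have h1 : ((S k).card : ℝ) ≤ ∑ n ∈ F, ∑ M ∈ P n, ((ch (j n) M).card : ℝ) := by
      have h2 : (S k).card ≤ ∑ n ∈ F, ∑ M ∈ P n, (ch (j n) M).card := by
        refine (Finset.card_le_card hsub).trans (Finset.card_biUnion_le.trans ?_)
        exact Finset.sum_le_sum (fun n _ => Finset.card_biUnion_le)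
      exact_mod_cast h2
    refine h1.trans ?_
    rw [Finset.mul_sum]
    refine Finset.sum_le_sum (fun n hn => ?_)
    refine (Finset.sum_le_sum (hchild n hn)).trans ?_
    rw [Finset.sum_const, nsmul_eq_mul]
    have := hPc n
    calc ((P n).card : ℝ) * (C * (S k).card * ((1 / 2 : ℝ) ^ j n) ^ T)
        ≤ 49 * (C * (S k).card * ((1 / 2 : ℝ) ^ j n) ^ T) := by gcongr
      _ = _ := by ring
  have hsmall : ∑ n ∈ F, ((1 / 2 : ℝ) ^ j n) ^ T ≤ 1 / (100 * C) := by
    have h1 : ENNReal.ofReal (∑ n ∈ F, ((1 / 2 : ℝ) ^ j n) ^ T) ≤ ENNReal.ofReal (1 / (100 * C)) := by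
      rw [ENNReal.ofReal_sum_of_nonneg (fun _ _ => by positivity)]
      have hgeo : ∑' n : ℕ, ENNReal.ofReal (η / 2 * (1 / 2) ^ n) = ENNReal.ofReal η := by
        rw [← ENNReal.ofReal_tsum_of_nonneg (fun n => by positivity)
          (summable_geometric_two.mul_left _), tsum_mul_left, tsum_geometric_two]
        congr 1
        ring
      calc ∑ n ∈ F, ENNReal.ofReal (((1 / 2 : ℝ) ^ j n) ^ T)
          ≤ ∑ n ∈ F, (ENNReal.ofReal ((2 : ℝ) ^ T) * τ n +
              ENNReal.ofReal (η / 2 * (1 / 2) ^ n)) := Finset.sum_le_sum (fun n _ => hjs n)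
        _ ≤ ∑' n, (ENNReal.ofReal ((2 : ℝ) ^ T) * τ n +
              ENNReal.ofReal (η / 2 * (1 / 2) ^ n)) := ENNReal.sum_le_tsum F
        _ = ENNReal.ofReal ((2 : ℝ) ^ T) * ∑' n, τ n + ENNReal.ofReal η := by
            rw [ENNReal.tsum_add, ENNReal.tsum_mul_left, hgeo]
        _ ≤ ENNReal.ofReal ((2 : ℝ) ^ T) * ENNReal.ofReal ε + ENNReal.ofReal η := by
            gcongr
        _ = ENNReal.ofReal (1 / (100 * C)) := by
            rw [← ENNReal.ofReal_mul (by positivity), ← ENNReal.ofReal_add (by positivity) hη0.le]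
            congr 1
            rw [hε, hη]
            field_simp
            norm_num
    exact (ENNReal.ofReal_le_ofReal_iff (by positivity)).mp h1
  have hfinal : ((S k).card : ℝ) ≤ 49 * C * (S k).card * (1 / (100 * C)) :=
    hbig.trans (by gcongr)
  have e : 49 * C * ((S k).card : ℝ) * (1 / (100 * C)) = 49 / 100 * (S k).card := by
    field_simp
  rw [e] at hfinal
  have := hSpos k
  linarith

lemma exists_jump {K : Set Plane} {S : ℕ → Finset (Fin 2 → ℤ)} (h : IsCells K S)
    (hK : IsCompact K) (hne : K.Nonempty) {C : ℝ} (hC0 : 0 < C)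
    (hC : ∀ j k : ℕ, j ≤ k → ∀ m : Fin 2 → ℤ, (dyadicCube 2 j m ∩ K).Nonempty →
      (covNum 2 j K : ℝ) * (covNum 2 k (K ∩ dyadicCube 2 j m) : ℝ) ≤ C * (covNum 2 k K : ℝ))
    {t s ε a n : ℝ} (ht0 : 0 < t) (ht : dimH K = ENNReal.ofReal t) (hε : 0 < ε) (hεs : ε < s)
    (ha' : 0 < s - t + 1 - ε) (ha : |a| ≤ n) {L : ℕ} (hL : 3 ≤ L)
    (hLC : 16 * C ≤ (2 : ℝ) ^ ((L : ℝ) * (s - t + 1 - ε)))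
    {e z : Plane} (he : e 1 = a * e 0) (hz : z ∈ K)
    (hs : s ≤ lowerBoxDim (K ∩ lineThrough e z)) (J : ℕ) :
    ∃ j, J ≤ j ∧ z ∈ jumpSet K S a n L j
      ((S j).card * (2 : ℝ) ^ ((j : ℝ) * (s - t + 1 - ε)) / 2 ^ j) := by
  have hn : 0 ≤ n := (abs_nonneg a).trans ha
  have hSpos : ∀ i, (0 : ℝ) < (S i).card := by
    intro i
    have : 0 < (S i).card := Finset.card_pos.mpr ⟨cell i z, (isCells_iff h _ _).mpr ⟨z, hz, rfl⟩⟩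
    exact_mod_cast this
  have hlog2 : 0 < Real.log 2 := Real.log_pos (by norm_num)
  set J0 := max J L with hJ0
  have hev : ∀ᶠ k : ℕ in Filter.atTop, s - ε / 4 <
      Real.log (covNum 2 k (K ∩ lineThrough e z)) / ((k : ℝ) * Real.log 2) := by
    refine Filter.eventually_lt_of_lt_liminf (lt_of_lt_of_le (by linarith) hs) ?_
    refine ⟨0, ?_⟩
    rw [Filter.eventually_map]
    refine Filter.Eventually.of_forall (fun k => ?_)
    have := Real.log_natCast_nonneg (covNum 2 k (K ∩ lineThrough e z))
    show (0 : ℝ) ≤ _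
    positivity
  obtain ⟨k1, hk1⟩ := Filter.eventually_atTop.mp hev
  obtain ⟨k2, hk2⟩ := exists_nat_gt (J0 / (ε / 2))
  obtain ⟨k, hk, hNk⟩ := good_scales h hK hne hC0 hC (t + ε / 4) (by linarith)
    (by rw [ht]; exact (ENNReal.ofReal_lt_ofReal_iff (by linarith)).mpr (by linarith))
    (max (max k1 k2) 1)
  have hkk1 : k1 ≤ k := le_trans (by simp) hk
  have hkk2 : k2 ≤ k := le_trans (by simp) hk
  have hkk3 : 1 ≤ k := le_trans (by simp) hk
  have hk0 : (0 : ℝ) < k := by exact_mod_cast hkk3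
  set q : ℕ → ℝ := fun j => cnt (S j) a (icpt a j z) (4 * (1 + n)) * 2 ^ j / (S j).card with hq
  have hcov : (2 : ℝ) ^ ((k : ℝ) * (s - ε / 4)) ≤ cnt (S k) a (icpt a k z) (4 * (1 + n)) := by
    have h1 := hk1 k hkk1
    rw [lt_div_iff₀ (by positivity)] at h1
    have h2 : (covNum 2 k (K ∩ lineThrough e z) : ℝ) ≤
        cnt (S k) a (icpt a k z) (4 * (1 + n)) := by
      have h3 := slice_cov h ha e z he k
      have h4 : cnt (S k) a (icpt a k z) (1 + n) ≤ cnt (S k) a (icpt a k z) (4 * (1 + n)) := by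
        unfold cnt
        apply Finset.card_le_card
        intro m hm
        rw [Finset.mem_filter] at hm ⊢
        exact ⟨hm.1, hm.2.trans (by linarith)⟩
      exact_mod_cast h3.trans h4
    refine le_trans ?_ h2
    have h5 : 0 < (s - ε / 4) * ((k : ℝ) * Real.log 2) := by
      have : 0 < s - ε / 4 := by linarith
      positivity
    have h6 : (0 : ℝ) < covNum 2 k (K ∩ lineThrough e z) := by
      by_contra hc
      have : (covNum 2 k (K ∩ lineThrough e z) : ℝ) = 0 :=
        le_antisymm (not_lt.mp hc) (Nat.cast_nonneg _)
      rw [this, Real.log_zero] at h1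
      linarith
    rw [← Real.log_le_log_iff (by positivity) h6, Real.log_rpow (by norm_num)]
    linarith
  have hY : (J0 : ℝ) < k * (ε / 2) := by
    rw [div_lt_iff₀ (by positivity)] at hk2
    have : (k2 : ℝ) ≤ k := by exact_mod_cast hkk2
    nlinarith
  obtain ⟨i, hi1, hi2, hi3⟩ := step_down q L J0 (by omega) (le_max_right _ _)
    ((2 : ℝ) ^ ((k : ℝ) * (ε / 2))) (s - t + 1 - ε) (Real.one_le_rpow (by norm_num) (by positivity))
    (by
      intro j hj
      have h1 : q j ≤ 2 ^ j := by
        rw [hq]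
        simp only
        rw [div_le_iff₀ (hSpos j), mul_comm]
        gcongr
        exact cnt_le_card _ _ _ _
      have h2 : (2 : ℝ) ^ j < (2 : ℝ) ^ ((k : ℝ) * (ε / 2)) := by
        rw [← Real.rpow_natCast]
        apply Real.rpow_lt_rpow_of_exponent_lt (by norm_num)
        have : (j : ℝ) < J0 := by exact_mod_cast hj
        linarith
      have h3 : (1 : ℝ) ≤ (2 : ℝ) ^ ((j : ℝ) * (s - t + 1 - ε)) :=
        Real.one_le_rpow (by norm_num) (by positivity)
      have h4 : (0 : ℝ) < 2 ^ j := by positivity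
      nlinarith) k
    (by
      rw [hq]
      simp only
      rw [le_div_iff₀ (hSpos k)]
      have e1 : (2 : ℝ) ^ ((k : ℝ) * (ε / 2)) * (2 : ℝ) ^ ((k : ℝ) * (s - t + 1 - ε)) *
          (2 : ℝ) ^ ((k : ℝ) * (t + ε / 4)) = (2 : ℝ) ^ ((k : ℝ) * (s - ε / 4)) * 2 ^ k := by
        rw [← Real.rpow_natCast, ← Real.rpow_add (by norm_num), ← Real.rpow_add (by norm_num),
          ← Real.rpow_add (by norm_num)]
        congr 1
        ring
      calc _ ≤ (2 : ℝ) ^ ((k : ℝ) * (ε / 2)) * (2 : ℝ) ^ ((k : ℝ) * (s - t + 1 - ε)) *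
          (2 : ℝ) ^ ((k : ℝ) * (t + ε / 4)) := by gcongr
        _ = _ := e1
        _ ≤ _ := by gcongr)
  refine ⟨i + L, (le_max_left _ _).trans hi1, hz, ?_, ?_⟩
  · rw [hq] at hi2
    simp only at hi2
    rw [le_div_iff₀ (hSpos _)] at hi2
    rw [div_le_iff₀ (by positivity)]
    linarith
  · have h1 := parent_cnt h ha hC i L z
    rw [hq] at hi3
    simp only at hi3
    have hNi := hSpos i
    have hNj := hSpos (i + L)
    rw [← mul_div_assoc, div_le_div_iff₀ hNi hNj] at hi3
    set X : ℝ := (cnt (S i) a (icpt a i z) (4 * (1 + n)) : ℝ) with hX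
    set Z : ℝ := (cnt (S (i + L)) a (icpt a (i + L) z) (4 * (1 + n)) : ℝ) with hZ
    have hX0 : 0 ≤ X := by rw [hX]; positivity
    have h2 : 16 * C * X * (S (i + L)).card ≤ Z * 2 ^ L * (S i).card := by
      have h3 : (0 : ℝ) < 2 ^ i := by positivity
      refine le_of_mul_le_mul_right ?_ h3
      calc 16 * C * X * (S (i + L)).card * 2 ^ i = 16 * C * (X * 2 ^ i) * (S (i + L)).card := by ring
        _ ≤ (2 : ℝ) ^ ((L : ℝ) * (s - t + 1 - ε)) * (X * 2 ^ i) * (S (i + L)).card := by gcongr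
        _ ≤ _ := hi3
        _ = _ := by rw [pow_add]; ring
    refine le_of_mul_le_mul_left ?_ hNi
    calc _ ≤ _ := h1
      _ = (16 * C * X * (S (i + L)).card) / 16 := by ring
      _ ≤ (Z * 2 ^ L * (S i).card) / 16 := by gcongr
      _ = _ := by ring

lemma summable_aux (C : ℝ) (hC : 0 ≤ C) (B : ℕ) (η : ℝ) (hη : 0 < η) :
    Summable (fun j : ℕ => C * (1 + Real.log (((B * 2 ^ j : ℕ) : ℝ) + 1)) ^ 2 /
      (2 : ℝ) ^ ((j : ℝ) * η)) := by
  set r : ℝ := (2 : ℝ) ^ (-η) with hr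
  have hr0 : 0 < r := by rw [hr]; positivity
  have hr1 : ‖r‖ < 1 := by
    rw [Real.norm_of_nonneg hr0.le, hr]
    exact Real.rpow_lt_one_of_one_lt_of_neg (by norm_num) (by linarith)
  have s2 := summable_pow_mul_geometric_of_norm_lt_one 2 hr1
  have s1 := summable_pow_mul_geometric_of_norm_lt_one 1 hr1
  have s0 := summable_pow_mul_geometric_of_norm_lt_one 0 hr1
  have hs := ((s2.add (s1.mul_left 2)).add s0).mul_left (C * (B + 2) ^ 2)
  refine Summable.of_nonneg_of_le (fun j => by positivity) (fun j => ?_) hs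
  have h1 : (2 : ℝ) ^ ((j : ℝ) * η) = (r ^ j)⁻¹ := by
    rw [hr, ← Real.rpow_natCast, ← Real.rpow_mul (by norm_num), ← Real.rpow_neg (by norm_num)]
    congr 1
    ring
  rw [h1, div_inv_eq_mul]
  have h0 : (0 : ℝ) ≤ Real.log (((B * 2 ^ j : ℕ) : ℝ) + 1) := by
    apply Real.log_nonneg
    have : (0 : ℝ) ≤ ((B * 2 ^ j : ℕ) : ℝ) := Nat.cast_nonneg _
    linarith
  have h2 : Real.log (((B * 2 ^ j : ℕ) : ℝ) + 1) ≤ B + j := by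
    have h3 : (((B * 2 ^ j : ℕ) : ℝ) + 1) ≤ (B + 1) * 2 ^ j := by
      push_cast
      have : (1 : ℝ) ≤ 2 ^ j := one_le_pow₀ (by norm_num)
      nlinarith
    calc _ ≤ Real.log ((B + 1) * 2 ^ j) := Real.log_le_log (by positivity) h3
      _ = Real.log (B + 1) + j * Real.log 2 := by
        rw [Real.log_mul (by positivity) (by positivity), Real.log_pow]
      _ ≤ B + j * 1 := by
        have h4 := Real.log_le_sub_one_of_pos (by positivity : (0 : ℝ) < B + 1)
        have h5 := Real.log_le_sub_one_of_pos (by norm_num : (0 : ℝ) < 2)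
        gcongr
        · linarith
        · linarith
      _ = _ := by ring
  have h3 : 1 + Real.log (((B * 2 ^ j : ℕ) : ℝ) + 1) ≤ (B + 2) * (j + 1) := by
    have : (0 : ℝ) ≤ (B : ℝ) * j := by positivity
    have : (0 : ℝ) ≤ (j : ℝ) := by positivity
    nlinarith
  calc C * (1 + Real.log (((B * 2 ^ j : ℕ) : ℝ) + 1)) ^ 2 * r ^ j
      ≤ C * ((B + 2) * (j + 1)) ^ 2 * r ^ j := by gcongr
    _ = _ := by ring

lemma ae_energy {K : Set Plane} {S : ℕ → Finset (Fin 2 → ℤ)} (h : IsCells K S) (hne : K.Nonempty)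
    (B : ℕ) (hB : ∀ j, ∀ m ∈ S j, ∀ m' ∈ S j, ∀ i, |m' i - m i| ≤ ((B * 2 ^ j : ℕ) : ℤ))
    (n : ℝ) (hn : 0 ≤ n) (L : ℕ) (hL : 3 ≤ L) (η : ℝ) (hη : 0 < η) :
    ∀ᵐ a : ℝ, |a| ≤ n → ∀ᶠ j : ℕ in Filter.atTop,
      energyG (bandKer (8 * (1 + n)) ((1 + n) * 2 ^ L)) (S j) a <
        (2 : ℝ) ^ ((j : ℝ) * η) * (S j).card := by
  have hL8 : (8 : ℝ) ≤ 2 ^ L := by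
    calc (8 : ℝ) = 2 ^ 3 := by norm_num
      _ ≤ 2 ^ L := pow_le_pow_right₀ (by norm_num) hL
  obtain ⟨C, hC, hbad⟩ := (bandKer_hyp (8 * (1 + n)) ((1 + n) * 2 ^ L) (by positivity)
    (by nlinarith)).bad_measure n hn
  have hSne : ∀ j, (S j).Nonempty := by
    intro j
    obtain ⟨z, hz⟩ := hne
    exact ⟨cell j z, (isCells_iff h _ _).mpr ⟨z, hz, rfl⟩⟩
  have hsum : ∑' j : ℕ, volume {a : ℝ | |a| ≤ n ∧ (2 : ℝ) ^ ((j : ℝ) * η) * (S j).card ≤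
      energyG (bandKer (8 * (1 + n)) ((1 + n) * 2 ^ L)) (S j) a} ≠ ⊤ := by
    refine ne_top_of_le_ne_top (summable_aux C hC B η hη).tsum_ofReal_ne_top ?_
    refine ENNReal.tsum_le_tsum (fun j => ?_)
    exact hbad (S j) (B * 2 ^ j) (hB j) (hSne j) _ (by positivity)
  filter_upwards [ae_eventually_notMem hsum] with a ha han
  filter_upwards [ha] with j hj
  by_contra hc
  exact hj ⟨han, not_lt.mp hc⟩

lemma ae_slope {K : Set Plane} (hK : IsCompact K) (hsub : SubUniformlyDistributed K)
    {t s : ℝ} (ht : dimH K = ENNReal.ofReal t) (ht0 : 0 < t)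
    (hs1 : max (t - 1) 0 < s) (n : ℝ) (hn : 0 ≤ n) (d : ℝ) (hd : max (t - s) 0 < d) :
    ∀ᵐ a : ℝ, |a| ≤ n → ∀ e : Plane, e 1 = a * e 0 →
      dimH {z | z ∈ K ∧ s ≤ lowerBoxDim (K ∩ lineThrough e z)} ≤ ENNReal.ofReal d := by
  classical
  obtain ⟨hbdd, C, hC0, hC⟩ := hsub
  have hne : K.Nonempty := by
    rw [nonempty_iff_ne_empty]
    rintro rfl
    rw [dimH_empty] at ht
    have := ENNReal.ofReal_pos.mpr ht0
    rw [← ht] at this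
    exact lt_irrefl _ this
  obtain ⟨S, h, B, hB⟩ := exists_cells hbdd
  have hst : t - 1 < s := (le_max_left _ _).trans_lt hs1
  have hs0 : 0 < s := (le_max_right _ _).trans_lt hs1
  have hd1 : t - s < d := (le_max_left _ _).trans_lt hd
  have hd0 : 0 < d := (le_max_right _ _).trans_lt hd
  obtain ⟨ε, hε, hε1, hε2, hε3⟩ : ∃ ε : ℝ, 0 < ε ∧ ε < s ∧ ε < s - t + 1 ∧ 2 * ε < d - (t - s) := by
    refine ⟨min (s / 2) (min ((s - t + 1) / 2) ((d - (t - s)) / 4)), ?_, ?_, ?_, ?_⟩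
    · refine lt_min (by linarith) (lt_min (by linarith) (by linarith))
    · exact (min_le_left _ _).trans_lt (by linarith)
    · exact ((min_le_right _ _).trans (min_le_left _ _)).trans_lt (by linarith)
    · have := (min_le_right (s / 2) (min ((s - t + 1) / 2) ((d - (t - s)) / 4))).trans
        (min_le_right _ _)
      linarith
  have ha' : 0 < s - t + 1 - ε := by linarith
  obtain ⟨L, hL, hLC⟩ : ∃ L : ℕ, 3 ≤ L ∧ 16 * C ≤ (2 : ℝ) ^ ((L : ℝ) * (s - t + 1 - ε)) := by
    have h1 : (1 : ℝ) < (2 : ℝ) ^ (s - t + 1 - ε) := Real.one_lt_rpow (by norm_num) ha'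
    obtain ⟨L, hL⟩ := pow_unbounded_of_one_lt (16 * C) h1
    refine ⟨max L 3, le_max_right _ _, ?_⟩
    rw [mul_comm ((max L 3 : ℕ) : ℝ), Real.rpow_mul (by norm_num), Real.rpow_natCast]
    exact hL.le.trans (pow_le_pow_right₀ h1.le (le_max_left _ _))
  filter_upwards [ae_energy h hne B hB n hn L hL ε hε] with a hae han e he
  obtain ⟨J1, hJ1⟩ := Filter.eventually_atTop.mp (hae han)
  set lam : ℕ → ℝ := fun j => (S j).card * (2 : ℝ) ^ ((j : ℝ) * (s - t + 1 - ε)) / 2 ^ j with hlam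
  have hSpos : ∀ i, (0 : ℝ) < (S i).card := by
    intro i
    obtain ⟨z, hz⟩ := hne
    have : 0 < (S i).card := Finset.card_pos.mpr ⟨cell i z, (isCells_iff h _ _).mpr ⟨z, hz, rfl⟩⟩
    exact_mod_cast this
  set Hit : ℕ → Finset (Fin 2 → ℤ) := fun j => (S j).filter
    (fun m => ∃ z ∈ jumpSet K S a n L j (lam j), m = cell j z) with hHit
  refine limsup_dim _ Hit ((16 * (1 + n)) ^ 2) (t - s + 2 * ε) d (by positivity) hd0 (by linarith)
    J1 ?_ ?_
  · intro j hj
    have hlp : 0 < lam j := by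
      have := hSpos j
      rw [hlam]
      positivity
    have h1 := hit_count (K := K) (S := S) han L hL j (lam j) hlp (Hit j) (Finset.filter_subset _ _)
      (fun m hm => (Finset.mem_filter.mp hm).2)
    have h2 := (hJ1 j hj).le
    refine le_of_mul_le_mul_right ?_ hlp
    calc _ ≤ _ := h1
      _ ≤ (16 * (1 + n)) ^ 2 * ((2 : ℝ) ^ ((j : ℝ) * ε) * (S j).card) := by gcongr
      _ = _ := by
        rw [hlam]
        simp only
        have e1 : (2 : ℝ) ^ ((j : ℝ) * ε) * 2 ^ j = (2 : ℝ) ^ ((j : ℝ) * (t - s + 2 * ε)) *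
            (2 : ℝ) ^ ((j : ℝ) * (s - t + 1 - ε)) := by
          rw [← Real.rpow_natCast, ← Real.rpow_add (by norm_num), ← Real.rpow_add (by norm_num)]
          congr 1
          ring
        have e2 : (2 : ℝ) ^ ((j : ℝ) * ε) = (2 : ℝ) ^ ((j : ℝ) * (t - s + 2 * ε)) *
            (2 : ℝ) ^ ((j : ℝ) * (s - t + 1 - ε)) / 2 ^ j := by
          rw [eq_div_iff (by positivity), e1]
        rw [e2]
        ring
  · rintro z ⟨hzK, hzs⟩ J
    obtain ⟨j, hj, hz⟩ := exists_jump h hK hne hC0 hC ht0 ht hε hε1 ha' han hL hLC he hzK hzs J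
    refine ⟨j, hj, cell j z, ?_, (mem_cube_iff _ _ _).mpr rfl⟩
    rw [hHit, Finset.mem_filter]
    exact ⟨(isCells_iff h _ _).mpr ⟨z, hzK, rfl⟩, z, hz, rfl⟩

lemma arctan_lip (x y : ℝ) : |Real.arctan x - Real.arctan y| ≤ |x - y| := by
  have h := Convex.norm_image_sub_le_of_norm_deriv_le (f := Real.arctan) (s := Set.univ) (C := 1)
    (x := y) (y := x) (fun z _ => Real.differentiable_arctan z) (fun z _ => by
      rw [Real.deriv_arctan]
      have : (1 : ℝ) ≤ 1 + z ^ 2 := by nlinarith [sq_nonneg z]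
      rw [Real.norm_of_nonneg (by positivity)]
      exact (div_le_one (by linarith)).mpr this) convex_univ (mem_univ _) (mem_univ _)
  simpa [Real.norm_eq_abs] using h

/-- The point of the unit circle (up to sign) of slope `a`. -/
def slopePt (σ a : ℝ) : Plane :=
  !₂[σ * Real.cos (Real.arctan a), σ * Real.sin (Real.arctan a)]

lemma slopePt_lip (σ : ℝ) (hσ : |σ| = 1) : LipschitzWith 2 (slopePt σ) := by
  apply LipschitzWith.of_dist_le_mul
  intro x y
  refine (plane_dist_le _ _).trans ?_
  have h0 : ∀ u v : ℝ, |σ * u - σ * v| = |u - v| := by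
    intro u v
    rw [← mul_sub, abs_mul, hσ, one_mul]
  have h1 := Real.abs_cos_sub_cos_le (Real.arctan x) (Real.arctan y)
  have h2 := Real.abs_sin_sub_sin_le (Real.arctan x) (Real.arctan y)
  have h3 := arctan_lip x y
  simp only [slopePt, Matrix.cons_val_zero, Matrix.cons_val_one, Matrix.cons_val_fin_one, h0,
    PiLp.toLp_apply]
  rw [Real.dist_eq]
  simp only [NNReal.coe_ofNat]
  linarith

lemma slope_null (Bad : Set ℝ) (hBad : volume Bad = 0) (σ : ℝ) (hσ : |σ| = 1) :
    μH[1] (slopePt σ '' Bad) = 0 := by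
  have h := (slopePt_lip σ hσ).lipschitzOnWith (s := Bad)
  have h1 := h.hausdorffMeasure_image_le (d := 1) (by norm_num)
  rw [hausdorffMeasure_real, hBad, mul_zero] at h1
  exact le_antisymm h1 zero_le

lemma circle_null (Bad : Set ℝ) (hBad : volume Bad = 0) :
    μH[1] {e : Plane | e ∈ unitCircle ∧ (e 0 = 0 ∨ e 1 / e 0 ∈ Bad)} = 0 := by
  have hpt : ∀ p : Plane, μH[1] ({p} : Set Plane) = 0 := by
    intro p
    have := Measure.nullSingletonClass_hausdorff Plane (d := 1) (by norm_num)
    exact measure_singleton p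
  have hsub : {e : Plane | e ∈ unitCircle ∧ (e 0 = 0 ∨ e 1 / e 0 ∈ Bad)} ⊆
      (({!₂[0, 1]} : Set Plane) ∪ {!₂[0, -1]}) ∪ (slopePt 1 '' Bad ∪ slopePt (-1) '' Bad) := by
    rintro e ⟨he, h⟩
    have hn : e 0 ^ 2 + e 1 ^ 2 = 1 := by
      have : ‖e‖ = 1 := by simpa [unitCircle] using he
      have h2 := EuclideanSpace.norm_sq_eq e
      rw [this, Fin.sum_univ_two] at h2
      simp only [Real.norm_eq_abs, sq_abs] at h2
      linarith
    by_cases h0 : e 0 = 0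
    · left
      rw [h0] at hn
      have : e 1 = 1 ∨ e 1 = -1 := sq_eq_one_iff.mp (by linarith)
      rcases this with h1 | h1
      · left
        rw [mem_singleton_iff]
        ext i
        fin_cases i <;> simp [h0, h1]
      · right
        rw [mem_singleton_iff]
        ext i
        fin_cases i <;> simp [h0, h1]
    · right
      have hB := h.resolve_left h0
      have hsq : 1 + (e 1 / e 0) ^ 2 = (1 / |e 0|) ^ 2 := by
        rw [div_pow, div_pow, sq_abs]
        field_simp
        linarith
      have hs : √(1 + (e 1 / e 0) ^ 2) = 1 / |e 0| := by
        rw [hsq, Real.sqrt_sq (by positivity)]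
      rcases lt_or_gt_of_ne h0 with hlt | hgt
      · right
        refine ⟨_, hB, ?_⟩
        unfold slopePt
        rw [Real.cos_arctan, Real.sin_arctan, hs, abs_of_neg hlt]
        ext i
        fin_cases i <;> simp <;> field_simp
      · left
        refine ⟨_, hB, ?_⟩
        unfold slopePt
        rw [Real.cos_arctan, Real.sin_arctan, hs, abs_of_pos hgt]
        ext i
        fin_cases i <;> simp <;> field_simp
  refine measure_mono_null hsub ?_
  rw [measure_union_null_iff, measure_union_null_iff, measure_union_null_iff]
  exact ⟨⟨hpt _, hpt _⟩, slope_null Bad hBad 1 (by simp), slope_null Bad hBad (-1) (by simp)⟩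

theorem statement10 (K : Set Plane) (t s : ℝ)
    (hK : IsCompact K) (hsub : SubUniformlyDistributed K)
    (ht : dimH K = ENNReal.ofReal t) (ht0 : 0 < t) (ht2 : t < 2)
    (hs1 : max (t - 1) 0 < s) (hs2 : s ≤ 1) :
    ∃ E : Set Plane, E ⊆ unitCircle ∧ μH[1] E = 0 ∧
      ∀ e ∈ unitCircle \ E,
        dimH {z | z ∈ K ∧ s ≤ lowerBoxDim (K ∩ lineThrough e z)}
          ≤ ENNReal.ofReal (max (t - s) 0) := by
  have hae : ∀ᵐ a : ℝ, ∀ n i : ℕ, |a| ≤ (n : ℝ) → ∀ e : Plane, e 1 = a * e 0 →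
      dimH {z | z ∈ K ∧ s ≤ lowerBoxDim (K ∩ lineThrough e z)} ≤
        ENNReal.ofReal (max (t - s) 0 + 1 / ((i : ℝ) + 1)) := by
    rw [ae_all_iff]
    intro n
    rw [ae_all_iff]
    intro i
    refine ae_slope hK hsub ht ht0 hs1 n (Nat.cast_nonneg n) _ ?_
    have : (0 : ℝ) < 1 / ((i : ℝ) + 1) := by positivity
    linarith
  rw [ae_iff] at hae
  refine ⟨_, fun e he => he.1, circle_null _ hae, ?_⟩
  rintro e ⟨heU, heE⟩
  have h1 : ¬ (e 0 = 0 ∨ e 1 / e 0 ∈ {a : ℝ | ¬ ∀ n i : ℕ, |a| ≤ (n : ℝ) → ∀ e : Plane,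
      e 1 = a * e 0 → dimH {z | z ∈ K ∧ s ≤ lowerBoxDim (K ∩ lineThrough e z)} ≤
        ENNReal.ofReal (max (t - s) 0 + 1 / ((i : ℝ) + 1))}) := fun hh => heE ⟨heU, hh⟩
  rw [not_or, notMem_setOf_iff, not_not] at h1
  obtain ⟨h0, h2⟩ := h1
  obtain ⟨n, hn⟩ := exists_nat_ge |e 1 / e 0|
  have h3 := fun i => h2 n i hn e (by field_simp)
  have hlim : Filter.Tendsto (fun i : ℕ => ENNReal.ofReal (max (t - s) 0 + 1 / ((i : ℝ) + 1)))
      Filter.atTop (nhds (ENNReal.ofReal (max (t - s) 0))) := by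
    apply ENNReal.tendsto_ofReal
    simpa using (tendsto_one_div_add_atTop_nhds_zero_nat (𝕜 := ℝ)).const_add (max (t - s) 0)
  exact ge_of_tendsto' hlim h3
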